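/- arXiv:2207.14728 — 4 statements merged into one kernel-verified Lean document; each statement's English description precedes it below -/
import Mathlib

section
/- Let G be a connected simple graph that is 2-regular or 3-regular (every vertex has degree exactly 2, or every vertex has degree exactly 3). If G is not isomorphic to any of the cycles C_3, C_4, C_5, the complete graph K_4, or the complete bipartite graph K_{3,3}, then G admits a distinguishing edge colouring with 2 colours. -/
open SimpleGraph

/-- `G` admits a distinguishing edge colouring with `k` colours. -/
def HasDistinguishingEdgeColoring {V : Type*} (G : SimpleGraph V) (k : ℕ) : Prop :=
  ∃ c : G.edgeSet → Fin k,
    ∀ φ : G ≃g G, (∀ e : G.edgeSet, c (φ.mapEdgeSet e) = c e) → ∀ v : V, φ v = v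

section

variable {V : Type*} {G : SimpleGraph V}

/-- An automorphism `φ` preserves the set of red edges described by the relation `r`. -/
def PreservesRed (r : V → V → Prop) (φ : G ≃g G) : Prop :=
  ∀ x y, G.Adj x y → (r (φ x) (φ y) ↔ r x y)

theorem hasDistinguishingEdgeColoring_two_of_red (r : V → V → Prop) (hr : ∀ ⦃x y⦄, r x y → r y x)
    (h : ∀ φ : G ≃g G, PreservesRed r φ → ∀ v, φ v = v) :
    HasDistinguishingEdgeColoring G 2 := by
  classical
  refine ⟨fun e => if e.1 ∈ Sym2.fromRel (r := r) ⟨hr⟩ then 1 else 0, fun φ hφ => h φ fun x y hxy => ?_⟩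
  have := hφ ⟨s(x, y), hxy⟩
  have key : ((φ.mapEdgeSet ⟨s(x, y), hxy⟩ : G.edgeSet) : Sym2 V) = s(φ x, φ y) := rfl
  simp only [key, Sym2.fromRel_prop] at this
  by_cases h1 : r (φ x) (φ y) <;> by_cases h2 : r x y <;> simp_all

theorem SimpleGraph.Connected.forall_of_adj (hconn : G.Connected) {P : V → Prop} {v₀ : V}
    (h₀ : P v₀) (hP : ∀ x y, G.Adj x y → P x → P y) (v : V) : P v := by
  obtain ⟨w⟩ := hconn.preconnected v₀ v
  induction w with
  | nil => exact h₀
  | cons hadj _ ih => exact ih (hP _ _ hadj h₀)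

/-- Every vertex has exactly three neighbours. -/
def IsCubic (G : SimpleGraph V) : Prop :=
  ∀ v, ∃ a b c, a ≠ b ∧ a ≠ c ∧ b ≠ c ∧ ∀ w, G.Adj v w ↔ w = a ∨ w = b ∨ w = c

theorem IsCubic.eq_or_eq_or_eq (h : IsCubic G) {v a b c d : V} (ha : G.Adj v a) (hb : G.Adj v b)
    (hc : G.Adj v c) (hab : a ≠ b) (hac : a ≠ c) (hbc : b ≠ c) (hd : G.Adj v d) :
    d = a ∨ d = b ∨ d = c := by
  obtain ⟨x, y, z, -, -, -, hw⟩ := h v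
  rw [hw] at ha hb hc hd
  grind

theorem IsCubic.exists_adj_ne_ne (h : IsCubic G) (v a b : V) :
    ∃ c, G.Adj v c ∧ c ≠ a ∧ c ≠ b := by
  obtain ⟨x, y, z, hxy, hxz, hyz, hw⟩ := h v
  by_cases hx : x ≠ a ∧ x ≠ b
  · exact ⟨x, (hw x).2 (by simp), hx⟩
  by_cases hy : y ≠ a ∧ y ≠ b
  · exact ⟨y, (hw y).2 (by simp), hy⟩
  · exact ⟨z, (hw z).2 (by simp), by grind, by grind⟩

/-- The distance of a vertex from the set `S`. -/
noncomputable def level (G : SimpleGraph V) (S : Set V) (x : V) : ℕ :=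
  ⨅ s : S, G.dist s x

theorem exists_dist_eq_level {S : Set V} (hS : S.Nonempty) (x : V) :
    ∃ s ∈ S, G.dist s x = level G S x := by
  have : Nonempty S := hS.to_subtype
  obtain ⟨s, hs⟩ := Nat.sInf_mem (Set.range_nonempty fun s : S => G.dist s x)
  exact ⟨s, s.2, hs⟩

theorem level_le_dist {S : Set V} {s : V} (hs : s ∈ S) (x : V) :
    level G S x ≤ G.dist s x :=
  Nat.sInf_le ⟨⟨s, hs⟩, rfl⟩

theorem level_eq_zero_iff (hconn : G.Connected) {S : Set V} (hS : S.Nonempty) {x : V} :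
    level G S x = 0 ↔ x ∈ S := by
  constructor
  · intro h
    obtain ⟨s, hs, hd⟩ := exists_dist_eq_level (G := G) hS x
    rw [h] at hd
    rwa [← (hconn.dist_eq_zero_iff).1 hd]
  · intro h
    simpa using level_le_dist (G := G) h x

theorem level_le_succ_of_adj (hconn : G.Connected) {S : Set V} (hS : S.Nonempty) {x y : V}
    (hxy : G.Adj x y) : level G S y ≤ level G S x + 1 := by
  obtain ⟨s, hs, hd⟩ := exists_dist_eq_level (G := G) hS x
  have h1 := level_le_dist (G := G) hs y
  have h2 := hconn.dist_triangle (u := s) (v := x) (w := y)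
  rw [dist_eq_one_iff_adj.2 hxy] at h2
  omega

theorem exists_adj_level_succ_eq (hconn : G.Connected) {S : Set V} (hS : S.Nonempty) {y : V}
    (hy : y ∉ S) : ∃ x, G.Adj y x ∧ level G S x + 1 = level G S y := by
  obtain ⟨s, hs, hd⟩ := exists_dist_eq_level (G := G) hS y
  have hne : y ≠ s := fun h => hy (h ▸ hs)
  obtain ⟨w, hw⟩ := hconn.exists_walk_length_eq_dist y s
  cases w with
  | nil => exact absurd rfl hne
  | @cons _ x _ hadj p =>
    refine ⟨x, hadj, ?_⟩
    have h1 := level_le_dist (G := G) hs x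
    have h2 := G.dist_le p
    have h3 := level_le_succ_of_adj hconn hS hadj.symm
    rw [Walk.length_cons, G.dist_comm, hd] at hw
    rw [G.dist_comm] at h2
    omega

/-- A red-blue colouring of the edges meeting `S` extends to an edge colouring for which only the
identity fixes `S` pointwise, without creating a vertex outside `S` with three red edges. -/
theorem exists_red_extension (hconn : G.Connected) (h3 : IsCubic G) {S : Set V}
    (hS : S.Nonempty)
    (hS1 : ∀ s ∈ S, ∀ x y, x ∉ S → y ∉ S → G.Adj s x → G.Adj s y → x = y)
    {r₀ : V → V → Prop} (hr₀ : ∀ ⦃x y⦄, r₀ x y → r₀ y x)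
    (hr₁ : ∀ x ∉ S, ∀ s ∈ S, ∀ t ∈ S, G.Adj x s → G.Adj x t → r₀ x s → r₀ x t → s = t) :
    ∃ r : V → V → Prop, (∀ ⦃x y⦄, r x y → r y x) ∧ (∀ s ∈ S, ∀ x, r s x ↔ r₀ s x) ∧
      (∀ x ∉ S, ∃ y, G.Adj x y ∧ ¬ r x y) ∧
      (∀ x ∉ S, ∀ y ∉ S, ∀ s ∈ S, ∀ t ∈ S, G.Adj x y → G.Adj s x → G.Adj t y →
        ∀ z ∉ S, ¬ r x z) ∧
      ∀ φ : G ≃g G, PreservesRed r φ → (∀ s ∈ S, φ s = s) → ∀ v, φ v = v := by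
  classical
  have : Nonempty V := hconn.nonempty
  set L := level G S with hL
  have hL0 : ∀ {x}, L x = 0 ↔ x ∈ S := level_eq_zero_iff hconn hS
  have hL1 : ∀ {x y}, G.Adj x y → L y ≤ L x + 1 := level_le_succ_of_adj hconn hS
  let parent : V → V := fun y => Classical.epsilon fun x => G.Adj y x ∧ L x + 1 = L y
  have hparent : ∀ {y}, y ∉ S → G.Adj y (parent y) ∧ L (parent y) + 1 = L y := fun hy =>
    Classical.epsilon_spec (exists_adj_level_succ_eq hconn hS hy)
  let blue : V → V := fun x => Classical.epsilon fun y => y ∉ S ∧ parent y = x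
  have hblue : ∀ {y}, y ∉ S → blue (parent y) ∉ S ∧ parent (blue (parent y)) = parent y :=
    fun {y} hy => Classical.epsilon_spec (p := fun z => z ∉ S ∧ parent z = parent y) ⟨y, hy, rfl⟩
  -- a vertex outside `S` has at most two children
  have htwo : ∀ {x y z w}, x ∉ S → y ∉ S → z ∉ S → parent y = x → parent z = x → y ≠ z →
      G.Adj x w → L w ≤ L x → w = parent x := by
    intro x y z w hx hy hz hyx hzx hyz hw hLw
    have h1 := hparent hx
    have h2 := hparent hy
    have h4 := hparent hz
    rw [hyx] at h2
    rw [hzx] at h4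
    have hne : ∀ {a b : V}, L a ≠ L b → a ≠ b := fun h h' => h (h' ▸ rfl)
    rcases h3.eq_or_eq_or_eq h1.1 h2.1.symm h4.1.symm (hne (by omega)) (hne (by omega)) hyz hw
      with h | h | h
    · exact h
    · rw [h] at hLw; omega
    · rw [h] at hLw; omega
  let r : V → V → Prop := fun x y => ((x ∈ S ∨ y ∈ S) ∧ r₀ x y) ∨ (x ∉ S ∧ y ∉ S ∧
    ((parent y = x ∧ y ≠ blue x) ∨ (parent x = y ∧ x ≠ blue y)))
  have hchild : ∀ {x y}, x ∉ S → y ∉ S → r x y →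
      (parent y = x ∧ y ≠ blue x) ∨ (parent x = y ∧ x ≠ blue y) := by
    intro x y hx hy h
    rcases h with h | h
    · tauto
    · exact h.2.2
  refine ⟨r, ?_, ?_, ?_, ?_, ?_⟩
  · intro x y h
    rcases h with ⟨h, h'⟩ | ⟨hx, hy, h⟩
    · exact Or.inl ⟨h.symm, hr₀ h'⟩
    · exact Or.inr ⟨hy, hx, h.symm⟩
  · intro s hs x
    simp only [r]
    tauto
  · intro x hx
    by_contra! hall
    have hpx := hparent hx
    -- every neighbour other than the parent is a red child
    have hc : ∀ y, G.Adj x y → y ≠ parent x → y ∉ S ∧ parent y = x ∧ y ≠ blue x := by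
      intro y hy hyp
      by_cases hyS : y ∈ S
      · exfalso
        have hy0 := hL0.2 hyS
        have := hL1 hy.symm
        have hpS : parent x ∈ S := hL0.1 (by omega)
        have hr : ∀ s ∈ S, G.Adj x s → r₀ x s := by
          intro s hs hxs
          rcases hall s hxs with h | h
          · exact h.2
          · exact absurd hs h.2.1
        exact hyp (hr₁ x hx y hyS _ hpS hy hpx.1 (hr y hyS hy) (hr _ hpS hpx.1))
      · rcases hchild hx hyS (hall y hy) with h | h
        · exact ⟨hyS, h⟩
        · exact absurd h.1.symm hyp
    obtain ⟨y, hy, hyp, -⟩ := h3.exists_adj_ne_ne x (parent x) (parent x)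
    obtain ⟨hyS, hyx, hyb⟩ := hc y hy hyp
    obtain ⟨hbS, hbx⟩ := hblue hyS
    rw [hyx] at hbS hbx
    have hb := hparent hbS
    rw [hbx] at hb
    exact (hc (blue x) hb.1.symm (by intro h; rw [h] at hb; omega)).2.2 rfl
  · intro x hx y hy s hs t ht hxy hsx hty z hz hr
    have hs0 := hL0.2 hs
    have ht0 := hL0.2 ht
    have h1 := hL1 hsx
    have h2 := hL1 hty
    have hpx := hparent hx
    have hpS : parent x ∈ S := hL0.1 (by omega)
    rcases hchild hx hz hr with h | h
    · obtain ⟨hbS, hbx⟩ := hblue hz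
      rw [h.1] at hbS hbx
      have hy0 : L y ≠ 0 := fun h => hy (hL0.1 h)
      have := htwo hx hz hbS h.1 hbx h.2 hxy (by omega)
      exact hy (this ▸ hpS)
    · exact hz (h.1 ▸ hpS)
  · intro φ hφ hφS
    suffices h : ∀ k v, L v ≤ k → φ v = v from fun v => h _ v le_rfl
    intro k
    induction k with
    | zero => exact fun v hv => hφS v (hL0.1 (by omega))
    | succ k ih =>
      intro y hy
      by_cases hyk : L y ≤ k
      · exact ih y hyk
      by_contra hne
      have hyS : y ∉ S := fun h => by have := hL0.2 h; omega
      have hpy := hparent hyS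
      have hfix : φ (parent y) = parent y := ih _ (by omega)
      have hadj : G.Adj (φ y) (parent y) := by
        rw [← hfix]; exact φ.map_adj_iff.2 hpy.1
      have hLφ : L (φ y) = L y := by
        have h1 := hL1 hadj.symm
        by_contra h
        exact hne (φ.injective (ih (φ y) (by omega)))
      have hφyS : φ y ∉ S := fun h => by have := hL0.2 h; omega
      by_cases hpS : parent y ∈ S
      · exact hne (hS1 _ hpS _ _ hφyS hyS hadj.symm hpy.1.symm)
      have hpφ : parent (φ y) = parent y := by
        simp only [parent]
        congr 1
        ext x
        rw [hLφ]
        refine and_congr_left fun hx => ?_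
        conv_lhs => rw [← ih x (by omega)]
        exact φ.map_adj_iff
      have hcol := hφ _ _ hpy.1.symm
      rw [hfix] at hcol
      have hnp : ∀ {z}, L z = L y → parent (parent y) ≠ z := by
        intro z hz h
        have := (hparent hpS).2
        rw [h] at this
        omega
      have hred : ∀ {z}, z ∉ S → L z = L y → parent z = parent y →
          (r (parent y) z ↔ z ≠ blue (parent y)) := by
        intro z hz hLz hpz
        constructor
        · intro h
          rcases hchild hpS hz h with h | h
          · exact h.2
          · exact absurd h.1 (hnp hLz)
        · exact fun h => Or.inr ⟨hpS, hz, Or.inl ⟨hpz, h⟩⟩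
      rw [hred hφyS hLφ hpφ, hred hyS rfl rfl] at hcol
      -- one of the two siblings `y`, `φ y` is the blue one, else there are three children
      have hb := hblue hyS
      by_cases h : y = blue (parent y)
      · exact hcol.1 (fun h' => hne (h'.trans h.symm)) h
      · have h' : φ y ≠ blue (parent y) := hcol.2 h
        have hpb := hparent hb.1
        rw [hb.2] at hpb
        have h5 := hparent hpS
        rcases h3.eq_or_eq_or_eq hpy.1.symm hadj.symm hpb.1.symm (Ne.symm hne) h h' h5.1
          with h6 | h6 | h6
        · exact hnp rfl h6
        · exact hnp hLφ h6
        · exact hnp (by omega) h6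

/-- The closed (possibly bi-infinite) induced cycle `c` can be fixed pointwise by a red-blue
colouring of the edges meeting it. -/
theorem hasDistinguishingEdgeColoring_of_inducedCycle (hconn : G.Connected) (h3 : IsCubic G)
    {n : ℕ} (hn1 : n ≠ 1) (hn2 : n ≠ 2) (c : ZMod n → V) (hinj : Function.Injective c)
    (hadj : ∀ i j, G.Adj (c i) (c j) ↔ j = i + 1 ∨ i = j + 1)
    (hout : ∀ x ∉ Set.range c, ∀ i j, G.Adj x (c i) → G.Adj x (c j) → i = j) :
    HasDistinguishingEdgeColoring G 2 := by
  have htwo : (1 : ZMod n) + 1 ≠ 0 := by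
    intro h
    have h2 : ((2 : ℕ) : ZMod n) = 0 := by rw [← h]; norm_num
    have := Nat.le_of_dvd (by norm_num) ((ZMod.natCast_eq_zero_iff 2 n).1 h2)
    interval_cases n <;> simp_all
  have hone : (1 : ZMod n) ≠ 0 := fun h => htwo (by rw [h, add_zero])
  have hshift : ∀ i : ZMod n, i + 1 + 1 ≠ i := fun i h => htwo (by linear_combination h)
  have hpm : (1 : ZMod n) ≠ -1 := fun h => htwo (by linear_combination h)
  have hsucc : ∀ i, G.Adj (c i) (c (i + 1)) := fun i => (hadj _ _).2 (Or.inl rfl)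
  have hpred : ∀ i, G.Adj (c (i + 1)) (c i) := fun i => (hsucc i).symm
  let r₀ : V → V → Prop := fun x y => (x = c 0 → y = c (-1)) ∧ (y = c 0 → x = c (-1))
  have hS1 : ∀ s ∈ Set.range c, ∀ x y, x ∉ Set.range c → y ∉ Set.range c → G.Adj s x →
      G.Adj s y → x = y := by
    rintro _ ⟨i, rfl⟩ x y hx hy hix hiy
    have hi := hpred (i - 1)
    rw [sub_add_cancel] at hi
    have hne : ∀ {z j}, z ∉ Set.range c → c j ≠ z := fun hz h => hz ⟨_, h⟩
    rcases h3.eq_or_eq_or_eq hi (hsucc i) hix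
      (fun h => hshift (i - 1) (by simpa using (hinj h).symm)) (hne hx) (hne hx) hiy
      with h | h | h
    · exact absurd ⟨_, h.symm⟩ hy
    · exact absurd ⟨_, h.symm⟩ hy
    · exact h.symm
  obtain ⟨r, hsymm, hrS, hrD, hrP, hfix⟩ := exists_red_extension hconn h3 (Set.range_nonempty c)
    hS1 (r₀ := r₀) (fun x y h => ⟨h.2, h.1⟩) (by
      rintro x hx _ ⟨i, rfl⟩ _ ⟨j, rfl⟩ hxi hxj - -
      rw [hout x hx i j hxi hxj])
  refine hasDistinguishingEdgeColoring_two_of_red r hsymm fun φ hφ => hfix φ hφ ?_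
  have hrc : ∀ i x, r (c i) x ↔ r₀ (c i) x := fun i x => hrS _ ⟨i, rfl⟩ x
  -- the vertices all of whose edges are red
  let D : V → Prop := fun v => ∀ y, G.Adj v y → r v y
  have hD : ∀ v, D v ↔ ∃ i, i ≠ 0 ∧ i ≠ 1 ∧ c i = v := by
    intro v
    constructor
    · intro hv
      by_cases hvS : v ∈ Set.range c
      · obtain ⟨i, rfl⟩ := hvS
        refine ⟨i, ?_, ?_, rfl⟩
        · rintro rfl
          have h := ((hrc _ _).1 (hv _ (hsucc 0))).1 rfl
          rw [zero_add] at h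
          exact hpm (hinj h)
        · rintro rfl
          have h := ((hrc _ _).1 (hv (c 0) (by simpa using hpred 0))).2 rfl
          exact hpm (hinj h)
      · obtain ⟨y, hy, hy'⟩ := hrD v hvS
        exact absurd (hv y hy) hy'
    · rintro ⟨i, hi0, hi1, rfl⟩ y hy
      refine (hrc _ _).2 ⟨fun h => absurd (hinj h) hi0, ?_⟩
      rintro rfl
      rcases (hadj _ _).1 hy with h | h
      · congr 1; linear_combination -h
      · exact absurd (by simpa using h) hi1
  have hDφ : ∀ v, D (φ v) ↔ D v := by
    intro v
    constructor
    · intro h y hy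
      exact (hφ _ _ hy).1 (h _ (φ.map_adj_iff.2 hy))
    · intro h y hy
      obtain ⟨y, rfl⟩ := φ.surjective y
      have hy' := φ.map_adj_iff.1 hy
      exact (hφ _ _ hy').2 (h _ hy')
  have hD0 : ¬ D (c 0) := by
    rw [hD]; rintro ⟨i, h0, -, h⟩; exact h0 (hinj h)
  have hD1 : ¬ D (c 1) := by
    rw [hD]; rintro ⟨i, -, h1, h⟩; exact h1 (hinj h)
  have hDS : ∀ {v}, v ∉ Set.range c → ¬ D v := by
    intro v hv h
    obtain ⟨i, -, -, h⟩ := (hD v).1 h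
    exact hv ⟨i, h⟩
  -- the property singling out the pair `(c 0, c 1)`
  let Q : V → V → Prop := fun x y => G.Adj x y ∧ ¬ D x ∧ ¬ D y ∧ (∃ u, G.Adj x u ∧ D u) ∧
    (∃ u, G.Adj y u ∧ D u) ∧ ∃ z, G.Adj y z ∧ r y z ∧ ¬ D z
  have hQφ : ∀ x y, Q x y → Q (φ x) (φ y) := by
    rintro x y ⟨h1, h2, h4, ⟨u, hu, hu'⟩, ⟨v, hv, hv'⟩, z, hz, hz', hz''⟩
    exact ⟨φ.map_adj_iff.2 h1, by rwa [hDφ], by rwa [hDφ],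
      ⟨φ u, φ.map_adj_iff.2 hu, by rwa [hDφ]⟩, ⟨φ v, φ.map_adj_iff.2 hv, by rwa [hDφ]⟩,
      φ z, φ.map_adj_iff.2 hz, (hφ _ _ hz).2 hz', by rwa [hDφ]⟩
  have hnotD : ∀ i, ¬ D (c i) → i = 0 ∨ i = 1 := by
    intro i hi
    by_contra! h
    exact hi ((hD _).2 ⟨i, h.1, h.2, rfl⟩)
  have h01 : G.Adj (c 0) (c 1) := by simpa using hsucc 0
  have hm1 : G.Adj (c 0) (c (-1)) := by simpa using hpred (-1)
  have h12 : G.Adj (c 1) (c (1 + 1)) := hsucc 1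
  have hDm1 : D (c (-1)) := (hD _).2 ⟨-1, by simpa using hone, hpm.symm, rfl⟩
  have hD2 : D (c (1 + 1)) := (hD _).2 ⟨1 + 1, htwo, by simpa using hone, rfl⟩
  have hQ01 : Q (c 0) (c 1) := by
    refine ⟨h01, hD0, hD1, ⟨_, hm1, hDm1⟩, ⟨_, h12, hD2⟩, ?_⟩
    obtain ⟨z, hz, hz0, hz2⟩ := h3.exists_adj_ne_ne (c 1) (c 0) (c (1 + 1))
    refine ⟨z, hz, ?_, ?_⟩
    · exact (hrc _ _).2 ⟨fun h => absurd (hinj h) hone, fun h => absurd h hz0⟩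
    · rw [hD]
      rintro ⟨i, hi0, hi1, rfl⟩
      rcases (hadj _ _).1 hz with h | h
      · exact hz2 (by rw [h])
      · exact hi0 (by linear_combination -h)
  have hQ : ∀ x y, Q x y → x = c 0 ∧ y = c 1 := by
    rintro x y ⟨hxy, hx, hy, ⟨u, hxu, hu⟩, ⟨v, hyv, hv⟩, z, hyz, hz, hzD⟩
    obtain ⟨i, hi0, hi1, rfl⟩ := (hD u).1 hu
    obtain ⟨j, hj0, hj1, rfl⟩ := (hD v).1 hv
    by_cases hxS : x ∈ Set.range c <;> by_cases hyS : y ∈ Set.range c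
    · obtain ⟨k, rfl⟩ := hxS
      obtain ⟨l, rfl⟩ := hyS
      rcases hnotD l hy with rfl | rfl
      · have h := ((hrc _ _).1 hz).1 rfl
        exact absurd (h ▸ hDm1) hzD
      · rcases hnotD k hx with rfl | rfl
        · exact ⟨rfl, rfl⟩
        · exact absurd hxy (G.loopless.irrefl _)
    · obtain ⟨k, rfl⟩ := hxS
      have := hout y hyS k j hxy.symm hyv
      subst this
      exact absurd ((hD _).2 ⟨k, hj0, hj1, rfl⟩) hx
    · obtain ⟨l, rfl⟩ := hyS
      have := hout x hxS l i hxy hxu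
      subst this
      exact absurd ((hD _).2 ⟨l, hi0, hi1, rfl⟩) hy
    · by_cases hzS : z ∈ Set.range c
      · obtain ⟨k, rfl⟩ := hzS
        have := hout y hyS k j hyz hyv
        subst this
        exact absurd hv hzD
      · exact absurd hz (hrP y hyS x hxS _ ⟨j, rfl⟩ _ ⟨i, rfl⟩ hxy.symm hyv.symm hxu.symm z hzS)
  obtain ⟨hφ0, hφ1⟩ := hQ _ _ (hQφ _ _ hQ01)
  have hφS : ∀ i, φ (c i) ∈ Set.range c := by
    intro i
    by_cases hi0 : i = 0
    · exact ⟨0, by rw [hi0, hφ0]⟩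
    by_cases hi1 : i = 1
    · exact ⟨1, by rw [hi1, hφ1]⟩
    obtain ⟨j, -, -, h⟩ := (hD _).1 ((hDφ (c i)).2 ((hD _).2 ⟨i, hi0, hi1, rfl⟩))
    exact ⟨j, h⟩
  have hup : ∀ i, φ (c i) = c i → φ (c (i + 1)) = c (i + 1) →
      φ (c (i + 1 + 1)) = c (i + 1 + 1) := by
    intro i h0 h1
    obtain ⟨j, hj⟩ := hφS (i + 1 + 1)
    have h := φ.map_adj_iff.2 (hsucc (i + 1))
    rw [h1, ← hj] at h
    rcases (hadj _ _).1 h with h | h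
    · rw [← hj, h]
    · have : j = i := by linear_combination -h
      rw [this, ← h0] at hj
      exact absurd (hinj (φ.injective hj)).symm (hshift i)
  have hdown : ∀ i, φ (c (i + 1)) = c (i + 1) → φ (c (i + 1 + 1)) = c (i + 1 + 1) →
      φ (c i) = c i := by
    intro i h1 h2
    obtain ⟨j, hj⟩ := hφS i
    have h := φ.map_adj_iff.2 (hpred i)
    rw [h1, ← hj] at h
    rcases (hadj _ _).1 h with h | h
    · rw [h, ← h2] at hj
      exact absurd (hinj (φ.injective hj)) (hshift i)
    · rw [← hj]
      congr 1
      linear_combination -h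
  have hall : ∀ k : ℤ, φ (c (k : ZMod n)) = c k ∧ φ (c ((k : ZMod n) + 1)) = c ((k : ZMod n) + 1) := by
    intro k
    induction k using Int.induction_on with
    | zero => simpa using ⟨hφ0, hφ1⟩
    | succ k ih =>
      push_cast at ih ⊢
      exact ⟨ih.2, hup _ ih.1 ih.2⟩
    | pred k ih =>
      push_cast at ih ⊢
      rw [sub_add_cancel]
      refine ⟨hdown _ ?_ ?_, ih.1⟩
      · rw [sub_add_cancel]; exact ih.1
      · rw [sub_add_cancel]; exact ih.2
  rintro _ ⟨i, rfl⟩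
  obtain ⟨k, rfl⟩ := ZMod.intCast_surjective i
  exact (hall k).1

/-- A diamond in a cubic graph that is not contained in a complete graph on four vertices. -/
theorem hasDistinguishingEdgeColoring_of_diamond (hconn : G.Connected) (h3 : IsCubic G)
    {a b c x : V} (hab : G.Adj a b) (hac : G.Adj a c) (hbc : G.Adj b c) (hax : G.Adj a x)
    (hbx : G.Adj b x) (hcx : c ≠ x) (hncx : ¬ G.Adj c x) :
    HasDistinguishingEdgeColoring G 2 := by
  let r₀ : V → V → Prop := fun u v => u = a ∨ v = a ∨ (u = c ∧ v ≠ b) ∨ (v = c ∧ u ≠ b)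
  let S : Set V := {a, b, c, x}
  have hS : ∀ v, v ∈ S ↔ v = a ∨ v = b ∨ v = c ∨ v = x := fun v => Iff.rfl
  have hNa := fun v hv => h3.eq_or_eq_or_eq (d := v) hab hac hax hbc.ne hbx.ne hcx hv
  have hNb := fun v hv => h3.eq_or_eq_or_eq (d := v) hab.symm hbc hbx hac.ne hax.ne hcx hv
  have hS1 : ∀ s ∈ S, ∀ y z, y ∉ S → z ∉ S → G.Adj s y → G.Adj s z → y = z := by
    intro s hs y z hy hz hsy hsz
    rw [hS] at hs hy hz
    push Not at hy hz
    rcases hs with rfl | rfl | rfl | rfl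
    · have := hNa y hsy; tauto
    · have := hNb y hsy; tauto
    · have := h3.eq_or_eq_or_eq hac.symm hbc.symm hsy hab.ne hy.1.symm hy.2.1.symm hsz; tauto
    · have := h3.eq_or_eq_or_eq hax.symm hbx.symm hsy hab.ne hy.1.symm hy.2.1.symm hsz; tauto
  obtain ⟨r, hsymm, hrS, hrD, -, hfix⟩ := exists_red_extension hconn h3 ⟨a, Or.inl rfl⟩ hS1
    (r₀ := r₀) (fun u v h => by simp only [r₀] at h ⊢; tauto) (by
      intro y hy
      rw [hS] at hy
      have key : ∀ s ∈ S, G.Adj y s → r₀ y s → s = c := by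
        intro s hs hys hr
        have h1 : s ≠ a := by rintro rfl; have := hNa y hys.symm; tauto
        simp only [r₀] at hr
        tauto
      intro s hs t ht hys hyt hrs hrt
      rw [key s hs hys hrs, key t ht hyt hrt])
  refine hasDistinguishingEdgeColoring_two_of_red r hsymm fun φ hφ => hfix φ hφ ?_
  have hra : ∀ y, r a y := fun y => (hrS a (by simp [S]) y).2 (Or.inl rfl)
  have hra' : ∀ y, r y a := fun y => hsymm (hra y)
  have hrb : ∀ y, y ≠ a → ¬ r b y := by
    intro y hy
    rw [hrS b (by simp [S])]
    have := hab.ne'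
    have := hbc.ne
    simp only [r₀]
    tauto
  have hrx : ∀ y, G.Adj x y → r x y → y = a := by
    intro y hxy
    rw [hrS x (by simp [S])]
    rintro (h | h | h | h)
    · exact absurd h hax.ne'
    · exact h
    · exact absurd h.1 hcx.symm
    · rw [h.1] at hxy; exact absurd hxy.symm hncx
  have hφa : φ a = a := by
    have hall : ∀ y, G.Adj (φ a) y → r (φ a) y := by
      intro y hy
      obtain ⟨y, rfl⟩ := φ.surjective y
      exact (hφ _ _ (φ.map_adj_iff.1 hy)).2 (hra y)
    by_cases hs : φ a ∈ S
    · rcases (hS _).1 hs with h | h | h | h <;> rw [h] at hall ⊢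
      · exact absurd (hall c hbc) (hrb c hac.ne')
      · exact absurd (hsymm (hall b hbc.symm)) (hrb c hac.ne')
      · exact absurd (hsymm (hall b hbx.symm)) (hrb x hax.ne')
    · obtain ⟨y, hy, hy'⟩ := hrD _ hs
      exact absurd (hall y hy) hy'
  have hmap : ∀ v, G.Adj a v → G.Adj a (φ v) := fun v hv => by
    have := φ.map_adj_iff.2 hv
    rwa [hφa] at this
  have hφb : φ b = b := by
    have key : ∀ v, G.Adj a v → v ≠ φ b → G.Adj (φ b) v := by
      intro v hv hvb
      obtain ⟨v, rfl⟩ := φ.surjective v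
      rw [← hφa] at hv
      refine φ.map_adj_iff.2 ?_
      rcases hNa v (φ.map_adj_iff.1 hv) with rfl | rfl | rfl
      · exact absurd rfl hvb
      · exact hbc
      · exact hbx
    rcases hNa _ (hmap b hab) with h | h | h
    · exact h
    · rw [h] at key
      exact absurd (key x hax hcx.symm) hncx
    · rw [h] at key
      exact absurd (key c hac hcx).symm hncx
  have hφc : φ c = c := by
    rcases hNa _ (hmap c hac) with h | h | h
    · exact absurd (φ.injective (h.trans hφb.symm)) hbc.ne'
    · exact h
    · exfalso
      obtain ⟨s, hs, hsa, hsb⟩ := h3.exists_adj_ne_ne c a b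
      have hrs : r c s := (hrS c (by simp [S]) s).2 (by simp only [r₀]; tauto)
      have h1 := (hφ _ _ hs).2 hrs
      have h2 := φ.map_adj_iff.2 hs
      rw [h] at h1 h2
      exact hsa (φ.injective ((hrx _ h2 h1).trans hφa.symm))
  have hφx : φ x = x := by
    rcases hNa _ (hmap x hax) with h | h | h
    · exact absurd (φ.injective (h.trans hφb.symm)) hbx.ne'
    · exact absurd (φ.injective (h.trans hφc.symm)) hcx.symm
    · exact h
  intro s hs
  rcases (hS s).1 hs with rfl | rfl | rfl | rfl <;> assumption

/-- A complete bipartite subgraph `K_{2,3}` with parts `{a, b}` and `{x, y, z}` in a triangle-free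
cubic graph that is not contained in a `K_{3,3}`. -/
theorem hasDistinguishingEdgeColoring_of_completeBipartite (hconn : G.Connected) (h3 : IsCubic G)
    (htri : ∀ u v w, G.Adj u v → G.Adj v w → ¬ G.Adj u w)
    {a b x y z : V} (hab : a ≠ b) (hxy : x ≠ y) (hxz : x ≠ z) (hyz : y ≠ z)
    (hax : G.Adj a x) (hay : G.Adj a y) (haz : G.Adj a z)
    (hbx : G.Adj b x) (hby : G.Adj b y) (hbz : G.Adj b z)
    (huniq : ∀ w, G.Adj w x → G.Adj w y → G.Adj w z → w = a ∨ w = b) :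
    HasDistinguishingEdgeColoring G 2 := by
  let r₀ : V → V → Prop := fun u v => u = a ∨ v = a ∨ (u = b ∧ v = y) ∨ (u = y ∧ v = b) ∨
    (u = x ∧ v ≠ b) ∨ (v = x ∧ u ≠ b)
  let S : Set V := {a, b, x, y, z}
  have hS : ∀ v, v ∈ S ↔ v = a ∨ v = b ∨ v = x ∨ v = y ∨ v = z := fun v => Iff.rfl
  have hNa := fun v hv => h3.eq_or_eq_or_eq (d := v) hax hay haz hxy hxz hyz hv
  have hNb := fun v hv => h3.eq_or_eq_or_eq (d := v) hbx hby hbz hxy hxz hyz hv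
  have hS1 : ∀ s ∈ S, ∀ u v, u ∉ S → v ∉ S → G.Adj s u → G.Adj s v → u = v := by
    intro s hs u v hu hv hsu hsv
    have key : G.Adj a s → G.Adj b s → u = v := by
      intro has hbs
      rw [hS] at hu hv
      push Not at hu hv
      have := h3.eq_or_eq_or_eq has.symm hbs.symm hsu hab hu.1.symm hu.2.1.symm hsv
      tauto
    rw [hS] at hs hu
    rcases hs with rfl | rfl | rfl | rfl | rfl
    · have := hNa u hsu; tauto
    · have := hNb u hsu; tauto
    all_goals exact key ‹_› ‹_›
  obtain ⟨r, hsymm, hrS, hrD, -, hfix⟩ := exists_red_extension hconn h3 ⟨a, Or.inl rfl⟩ hS1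
    (r₀ := r₀) (fun u v h => by simp only [r₀] at h ⊢; tauto) (by
      intro w hw
      rw [hS] at hw
      have key : ∀ s ∈ S, G.Adj w s → r₀ w s → s = x := by
        intro s hs hws hr
        have h1 : s ≠ a := by rintro rfl; have := hNa w hws.symm; tauto
        simp only [r₀] at hr
        tauto
      intro s hs t ht hws hwt hrs hrt
      rw [key s hs hws hrs, key t ht hwt hrt])
  refine hasDistinguishingEdgeColoring_two_of_red r hsymm fun φ hφ => hfix φ hφ ?_
  have hra : ∀ w, r a w := fun w => (hrS a (by simp [S]) w).2 (Or.inl rfl)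
  have hrb : ∀ w, G.Adj b w → (r b w ↔ w = y) := by
    intro w hw
    rw [hrS b (by simp [S])]
    have h1 := hbx.ne
    have h2 := hby.ne
    have h4 : w ≠ a := by rintro rfl; exact htri _ _ _ hbx hax.symm hw
    simp only [r₀]
    tauto
  have hrz : ∀ w, G.Adj z w → r z w → w = a := by
    intro w hzw
    have h1 : w ≠ x := by rintro rfl; exact htri _ _ _ haz hzw hax
    rw [hrS z (by simp [S])]
    have h2 := haz.ne'
    have h4 := hbz.ne'
    simp only [r₀]
    tauto
  have hφa : φ a = a := by
    have hall : ∀ w, G.Adj (φ a) w → r (φ a) w := by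
      intro w hw
      obtain ⟨w, rfl⟩ := φ.surjective w
      exact (hφ _ _ (φ.map_adj_iff.1 hw)).2 (hra w)
    by_cases hs : φ a ∈ S
    · rcases (hS _).1 hs with h | h | h | h | h <;> rw [h] at hall ⊢
      · exact absurd ((hrb x hbx).1 (hall x hbx)) hxy
      · exact absurd ((hrb x hbx).1 (hsymm (hall b hbx.symm))) hxy
      · obtain ⟨w, hw, hwa, hwb⟩ := h3.exists_adj_ne_ne y a b
        have h1 := (hrS y (by simp [S]) w).1 (hall w hw)
        have h2 := hay.ne'
        have h4 := hby.ne'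
        have h5 : w ≠ x := by rintro rfl; exact htri _ _ _ hay hw hax
        simp only [r₀] at h1
        tauto
      · exact absurd (hrz b hbz.symm (hall b hbz.symm)) hab.symm
    · obtain ⟨w, hw, hw'⟩ := hrD _ hs
      exact absurd (hall w hw) hw'
  have hmap : ∀ v, G.Adj a v → G.Adj a (φ v) := fun v hv => by
    have := φ.map_adj_iff.2 hv
    rwa [hφa] at this
  have hφb : φ b = b := by
    have key : ∀ v, G.Adj a v → G.Adj (φ b) v := by
      intro v hv
      obtain ⟨v, rfl⟩ := φ.surjective v
      rw [← hφa] at hv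
      refine φ.map_adj_iff.2 ?_
      rcases hNa v (φ.map_adj_iff.1 hv) with rfl | rfl | rfl <;> assumption
    rcases huniq _ (key x hax) (key y hay) (key z haz) with h | h
    · exact absurd (φ.injective (h.trans hφa.symm)) hab.symm
    · exact h
  have hφy : φ y = y := by
    have h1 := (hφ _ _ hby).2 ((hrb y hby).2 rfl)
    have h2 := φ.map_adj_iff.2 hby
    rw [hφb] at h1 h2
    exact (hrb _ h2).1 h1
  have hφx : φ x = x := by
    rcases hNa _ (hmap x hax) with h | h | h
    · exact h
    · exact absurd (φ.injective (h.trans hφy.symm)) hxy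
    · exfalso
      obtain ⟨w, hw, hwa, hwb⟩ := h3.exists_adj_ne_ne x a b
      have hrw : r x w := (hrS x (by simp [S]) w).2 (by simp only [r₀]; tauto)
      have h1 := (hφ _ _ hw).2 hrw
      have h2 := φ.map_adj_iff.2 hw
      rw [h] at h1 h2
      exact hwa (φ.injective ((hrz _ h2 h1).trans hφa.symm))
  have hφz : φ z = z := by
    rcases hNa _ (hmap z haz) with h | h | h
    · exact absurd (φ.injective (h.trans hφx.symm)) hxz.symm
    · exact absurd (φ.injective (h.trans hφy.symm)) hyz.symm
    · exact h
  intro s hs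
  rcases (hS s).1 hs with rfl | rfl | rfl | rfl | rfl <;> assumption

/-- There is a closed walk of positive length `n` without backtracking, except possibly at its
base point. -/
def HasClosedWalk (G : SimpleGraph V) (n : ℕ) : Prop :=
  0 < n ∧ ∃ f : ℕ → V, (∀ i < n, G.Adj (f i) (f (i + 1))) ∧ (∀ i, i + 2 ≤ n → f i ≠ f (i + 2)) ∧
    f n = f 0

theorem hasClosedWalk_of_adj {g : ℕ → V} {m : ℕ} (hg : ∀ i < m, G.Adj (g i) (g (i + 1)))
    (hg' : ∀ i, i + 2 ≤ m → g i ≠ g (i + 2)) (hm : g (m - 1) ≠ g 0) (h : G.Adj (g 0) (g m)) :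
    HasClosedWalk G (m + 1) := by
  refine ⟨by omega, fun k => if k ≤ m then g k else g 0, fun i hi => ?_, fun i hi => ?_, by simp⟩
  · by_cases h1 : i + 1 ≤ m
    · simpa [h1, show i ≤ m by omega] using hg i (by omega)
    · obtain rfl : i = m := by omega
      simpa using h.symm
  · by_cases h1 : i + 2 ≤ m
    · simpa [h1, show i ≤ m by omega] using hg' i h1
    · obtain rfl : i = m - 1 := by omega
      simpa [h1] using hm

theorem hasClosedWalk_of_adj_adj {g : ℕ → V} {m : ℕ} {x : V}
    (hg : ∀ i < m, G.Adj (g i) (g (i + 1)))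
    (hg' : ∀ i, i + 2 ≤ m → g i ≠ g (i + 2)) (hm : g m ≠ g 0) (hx : g (m - 1) ≠ x)
    (h0 : G.Adj x (g 0)) (h : G.Adj x (g m)) :
    HasClosedWalk G (m + 2) := by
  refine ⟨by omega, fun k => if k ≤ m then g k else if k = m + 1 then x else g 0,
    fun i hi => ?_, fun i hi => ?_, by simp⟩
  · by_cases h1 : i + 1 ≤ m
    · simpa [h1, show i ≤ m by omega] using hg i (by omega)
    · by_cases h2 : i = m
      · subst h2
        simpa using h.symm
      · obtain rfl : i = m + 1 := by omega
        simpa using h0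
  · by_cases h1 : i + 2 ≤ m
    · simpa [h1, show i ≤ m by omega] using hg' i h1
    · by_cases h2 : i = m
      · subst h2
        simpa using hm
      · obtain rfl : i = m - 1 := by omega
        simpa [h1, show m - 1 + 2 = m + 1 by omega] using hx

/-- A walk without backtracking in both directions. -/
theorem IsCubic.exists_int_walk (h3 : IsCubic G) [Nonempty V] :
    ∃ c : ℤ → V, (∀ i, G.Adj (c i) (c (i + 1))) ∧ ∀ i, c i ≠ c (i + 2) := by
  have hnx : ∀ u v, ∃ w, G.Adj v w ∧ w ≠ u := fun u v => by
    obtain ⟨w, h, h', -⟩ := h3.exists_adj_ne_ne v u u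
    exact ⟨w, h, h'⟩
  choose nx hnx hnx' using hnx
  let step : V × V → V × V := fun p => (p.2, nx p.1 p.2)
  let F : V → V → ℕ → V := fun a b k => (step^[k] (a, b)).1
  have hF2 : ∀ a b k, (step^[k] (a, b)).2 = F a b (k + 1) := fun a b k => by
    simp only [F, Function.iterate_succ_apply', step]
  have hF3 : ∀ a b k, F a b (k + 2) = nx (F a b k) (F a b (k + 1)) := fun a b k => by
    rw [← hF2, Function.iterate_succ_apply', ← hF2]
  have hadj : ∀ a b, G.Adj a b → ∀ k, G.Adj (F a b k) (F a b (k + 1)) := by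
    intro a b hab k
    cases k with
    | zero => exact hab
    | succ k => rw [hF3]; exact hnx _ _
  have hne : ∀ a b k, F a b k ≠ F a b (k + 2) := fun a b k => by
    rw [hF3]; exact (hnx' _ _).symm
  obtain ⟨a⟩ := ‹Nonempty V›
  obtain ⟨b, hab, -⟩ := h3.exists_adj_ne_ne a a a
  let c : ℤ → V := fun i => match i with
    | Int.ofNat k => F a b k
    | Int.negSucc k => F b a (k + 2)
  refine ⟨c, fun i => ?_, fun i => ?_⟩
  · match i with
    | Int.ofNat k => exact hadj a b hab k
    | Int.negSucc 0 => exact (hadj b a hab.symm 1).symm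
    | Int.negSucc (k + 1) => exact (hadj b a hab.symm (k + 2)).symm
  · match i with
    | Int.ofNat k => exact hne a b k
    | Int.negSucc 0 => exact (hne b a 0).symm
    | Int.negSucc 1 => exact (hne b a 1).symm
    | Int.negSucc (k + 2) => exact (hne b a (k + 2)).symm

theorem hasDistinguishingEdgeColoring_of_not_hasClosedWalk (hconn : G.Connected) (h3 : IsCubic G)
    (h : ∀ n, ¬ HasClosedWalk G n) : HasDistinguishingEdgeColoring G 2 := by
  have : Nonempty V := hconn.nonempty
  obtain ⟨c, hc, hc'⟩ := h3.exists_int_walk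
  have hseg : ∀ i : ℤ, ∀ m : ℕ, (∀ k < m, G.Adj (c (i + k)) (c (i + (k + 1 : ℕ)))) ∧
      ∀ k, k + 2 ≤ m → c (i + k) ≠ c (i + (k + 2 : ℕ)) := fun i m =>
    ⟨fun k _ => by simpa [add_assoc] using hc (i + k),
      fun k _ => by simpa [add_assoc] using hc' (i + k)⟩
  have hinj : ∀ (i : ℤ) (m : ℕ), 0 < m → c (i + m) ≠ c i := by
    intro i m hm heq
    exact h m ⟨hm, fun k => c (i + k), (hseg i m).1, (hseg i m).2, by simpa using heq⟩
  have hchord : ∀ (i : ℤ) (m : ℕ), G.Adj (c i) (c (i + m)) → m ≤ 1 := by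
    intro i m hadj
    by_contra! hm
    exact h _ (hasClosedWalk_of_adj (g := fun k => c (i + k)) (hseg i m).1 (hseg i m).2
      (by simpa using hinj i (m - 1) (by omega)) (by simpa using hadj))
  have houter : ∀ x ∉ Set.range c, ∀ (i : ℤ) (m : ℕ), G.Adj x (c i) → G.Adj x (c (i + m)) →
      m = 0 := by
    intro x hx i m h0 h1
    by_contra hm
    exact h _ (hasClosedWalk_of_adj_adj (g := fun k => c (i + k)) (x := x) (hseg i m).1
      (hseg i m).2 (by simpa using hinj i m (by omega)) (fun h' => hx ⟨_, h'⟩)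
      (by simpa using h0) (by simpa using h1))
  refine hasDistinguishingEdgeColoring_of_inducedCycle (n := 0) hconn h3 (by simp) (by simp) c
    ?_ ?_ ?_
  · intro (i : ℤ) (j : ℤ) hij
    change i = j
    rcases lt_trichotomy i j with hlt | heq | hlt
    · obtain ⟨m, rfl⟩ := Int.le.dest hlt.le
      exact absurd hij.symm (hinj i m (by omega))
    · exact heq
    · obtain ⟨m, rfl⟩ := Int.le.dest hlt.le
      exact absurd hij (hinj j m (by omega))
  · intro (i : ℤ) (j : ℤ)
    change G.Adj (c i) (c j) ↔ j = i + 1 ∨ i = j + 1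
    constructor
    · intro hadj
      have hne : i ≠ j := fun h' => hadj.ne (congrArg c h')
      rcases le_total i j with hle | hle
      · obtain ⟨m, rfl⟩ := Int.le.dest hle
        have := hchord i m hadj
        omega
      · obtain ⟨m, rfl⟩ := Int.le.dest hle
        have := hchord j m hadj.symm
        omega
    · rintro (rfl | rfl)
      · exact hc i
      · exact (hc j).symm
  · intro x hx (i : ℤ) (j : ℤ) hi hj
    change i = j
    rcases le_total i j with hle | hle
    · obtain ⟨m, rfl⟩ := Int.le.dest hle
      simp [houter x hx i m hi hj]
    · obtain ⟨m, rfl⟩ := Int.le.dest hle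
      simp [houter x hx j m hj hi]

theorem hasDistinguishingEdgeColoring_of_hasClosedWalk (hconn : G.Connected) (h3 : IsCubic G)
    (htri : ∀ u v w, G.Adj u v → G.Adj v w → ¬ G.Adj u w)
    (hquad : ∀ u v w x, G.Adj u v → G.Adj v w → G.Adj w x → G.Adj x u → u = w ∨ v = x)
    (h : ∃ n, HasClosedWalk G n) : HasDistinguishingEdgeColoring G 2 := by
  classical
  obtain ⟨n, ⟨hn0, f, hf, hf', hfn⟩, hmin⟩ :
      ∃ n, HasClosedWalk G n ∧ ∀ m < n, ¬ HasClosedWalk G m :=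
    ⟨Nat.find h, Nat.find_spec h, fun m => Nat.find_min h⟩
  have hn1 : n ≠ 1 := by
    rintro rfl
    exact (hf 0 one_pos).ne hfn.symm
  have hn2 : n ≠ 2 := by
    rintro rfl
    exact hf' 0 le_rfl hfn.symm
  have hseg : ∀ i m, i + m ≤ n → (∀ k < m, G.Adj (f (i + k)) (f (i + (k + 1)))) ∧
      ∀ k, k + 2 ≤ m → f (i + k) ≠ f (i + (k + 2)) := fun i m him =>
    ⟨fun k _ => hf (i + k) (by omega), fun k _ => hf' (i + k) (by omega)⟩
  have hinj : ∀ i m, i + m < n → 0 < m → f (i + m) ≠ f i := by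
    intro i m him hm heq
    have := hseg i m (by omega)
    exact hmin m (by omega) ⟨hm, fun k => f (i + k), this.1, this.2, heq⟩
  have hchord : ∀ i m, i + m < n → G.Adj (f i) (f (i + m)) → m ≤ 1 ∨ (i = 0 ∧ m = n - 1) := by
    intro i m him hadj
    by_contra! hm
    have h2 := hseg i m (by omega)
    exact hmin (m + 1) (by omega) (hasClosedWalk_of_adj (g := fun k => f (i + k)) h2.1 h2.2
      (hinj i (m - 1) (by omega) (by omega)) hadj)
  have hpred : G.Adj (f (n - 1)) (f 0) := by
    rw [← hfn]
    simpa [show n - 1 + 1 = n by omega] using hf (n - 1) (by omega)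
  have houter : ∀ x, (∀ k < n, f k ≠ x) → ∀ i m, i + m < n → G.Adj x (f i) →
      G.Adj x (f (i + m)) → m = 0 := by
    intro x hx i m him h0 h1
    by_contra hm
    have h2 := hseg i m (by omega)
    have hlen : ¬ m + 2 < n := fun hlt => hmin _ hlt
      (hasClosedWalk_of_adj_adj (g := fun k => f (i + k)) (x := x) h2.1 h2.2
        (hinj i m (by omega) (by omega)) (hx _ (by omega)) h0 h1)
    have hcases : (i = 0 ∧ m = n - 1) ∨ (i = 0 ∧ m = n - 2) ∨ (i = 1 ∧ m = n - 2) := by omega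
    rcases hcases with ⟨rfl, rfl⟩ | ⟨rfl, rfl⟩ | ⟨rfl, rfl⟩
    · rw [zero_add] at h1
      exact htri _ _ _ h1 hpred h0
    · rw [zero_add] at h1
      have h4 := hf (n - 2) (by omega)
      rw [show n - 2 + 1 = n - 1 by omega] at h4
      rcases hquad _ _ _ _ h1 h4 hpred h0.symm with h5 | h5
      · exact hx _ (by omega) h5.symm
      · have := hinj 0 (n - 2) (by omega) (by omega)
        rw [zero_add] at this
        exact this h5
    · rw [show 1 + (n - 2) = n - 1 by omega] at h1
      have h4 := hf 0 (by omega)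
      rcases hquad _ _ _ _ h1 hpred h4 h0.symm with h5 | h5
      · exact hx _ (by omega) h5.symm
      · have := hinj 1 (n - 2) (by omega) (by omega)
        rw [show 1 + (n - 2) = n - 1 by omega] at this
        exact this h5
  have : NeZero n := ⟨by omega⟩
  have hval : ∀ i j : ZMod n, j.val = i.val + 1 → j = i + 1 := by
    intro i j hij
    rw [← ZMod.natCast_zmod_val j, hij, Nat.cast_add, ZMod.natCast_zmod_val, Nat.cast_one]
  have hval' : ∀ i j : ZMod n, i.val = 0 → j.val = n - 1 → i = j + 1 := by
    intro i j hi hj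
    have h1 : ((j.val + 1 : ℕ) : ZMod n) = 0 := by
      rw [hj, show n - 1 + 1 = n by omega, ZMod.natCast_self]
    rw [Nat.cast_add, ZMod.natCast_zmod_val, Nat.cast_one] at h1
    rw [h1, ← ZMod.val_eq_zero, hi]
  have hsucc : ∀ i : ZMod n, G.Adj (f i.val) (f (i + 1).val) := by
    intro i
    have hi := ZMod.val_lt i
    have hcast : ((i.val + 1 : ℕ) : ZMod n) = i + 1 := by
      rw [Nat.cast_add, ZMod.natCast_zmod_val, Nat.cast_one]
    by_cases hlt : i.val + 1 < n
    · have : (i + 1).val = i.val + 1 := by rw [← hcast, ZMod.val_natCast_of_lt hlt]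
      rw [this]
      exact hf _ hi
    · have h1 : i.val = n - 1 := by omega
      have : (i + 1).val = 0 := by
        rw [← hcast, show i.val + 1 = n by omega, ZMod.natCast_self, ZMod.val_zero]
      rw [this, h1]
      exact hpred
  have hadj : ∀ i j : ZMod n, i.val ≤ j.val → G.Adj (f i.val) (f j.val) →
      j = i + 1 ∨ i = j + 1 := by
    intro i j hij hadj
    obtain ⟨m, hm⟩ := Nat.le.dest hij
    have hj := ZMod.val_lt j
    have hne : i.val ≠ j.val := fun h' => hadj.ne (congrArg f h')
    rw [← hm] at hadj
    rcases hchord _ _ (by omega) hadj with h' | h'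
    · exact Or.inl (hval i j (by omega))
    · exact Or.inr (hval' i j h'.1 (by omega))
  have hinj' : ∀ i j : ZMod n, i.val ≤ j.val → f i.val = f j.val → i = j := by
    intro i j hij heq
    obtain ⟨m, hm⟩ := Nat.le.dest hij
    have hj := ZMod.val_lt j
    by_contra hne
    have hm0 : m ≠ 0 := by
      rintro rfl
      exact hne (ZMod.val_injective n (by omega))
    rw [← hm] at heq
    exact hinj _ m (by omega) (by omega) heq.symm
  refine hasDistinguishingEdgeColoring_of_inducedCycle hconn h3 hn1 hn2 (fun i => f i.val)
    ?_ ?_ ?_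
  · intro i j hij
    rcases le_total i.val j.val with hle | hle
    · exact hinj' i j hle hij
    · exact (hinj' j i hle hij.symm).symm
  · intro i j
    constructor
    · intro h'
      rcases le_total i.val j.val with hle | hle
      · exact hadj i j hle h'
      · exact (hadj j i hle h'.symm).symm
    · rintro (rfl | rfl)
      · exact hsucc i
      · exact (hsucc j).symm
  · intro x hx
    have hx' : ∀ k < n, f k ≠ x := by
      intro k hk hkx
      exact hx ⟨(k : ZMod n), by simp only [ZMod.val_natCast_of_lt hk, hkx]⟩
    have key : ∀ i j : ZMod n, i.val ≤ j.val → G.Adj x (f i.val) → G.Adj x (f j.val) →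
        i = j := by
      intro i j hij hi hj
      obtain ⟨m, hm⟩ := Nat.le.dest hij
      have hj' := ZMod.val_lt j
      rw [← hm] at hj
      have := houter x hx' _ m (by omega) hi hj
      exact ZMod.val_injective n (by omega)
    intro i j hi hj
    rcases le_total i.val j.val with hle | hle
    · exact key i j hle hi hj
    · exact (key j i hle hj hi).symm

theorem injective_vecCons_three {a b c : V} (hab : a ≠ b) (hac : a ≠ c) (hbc : b ≠ c) :
    Function.Injective ![a, b, c] := by
  intro i j hij
  fin_cases i <;> fin_cases j <;> simp_all

theorem injective_vecCons_four {a b c d : V} (hab : a ≠ b) (hac : a ≠ c) (had : a ≠ d)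
    (hbc : b ≠ c) (hbd : b ≠ d) (hcd : c ≠ d) : Function.Injective ![a, b, c, d] := by
  intro i j hij
  fin_cases i <;> fin_cases j <;> simp_all

theorem nonempty_iso_of_closed (hconn : G.Connected) {W : Type*} [Nonempty W]
    {H : SimpleGraph W} (f : W → V) (hinj : Function.Injective f)
    (hadj : ∀ i j, G.Adj (f i) (f j) ↔ H.Adj i j)
    (hclosed : ∀ i v, G.Adj (f i) v → v ∈ Set.range f) : Nonempty (G ≃g H) := by
  have hsurj : ∀ v, v ∈ Set.range f :=
    hconn.forall_of_adj (v₀ := f (Classical.arbitrary W)) ⟨_, rfl⟩ (by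
      rintro _ y hxy ⟨i, rfl⟩
      exact hclosed i y hxy)
  exact ⟨(⟨Equiv.ofBijective f ⟨hinj, hsurj⟩, hadj _ _⟩ : H ≃g G).symm⟩

theorem IsCubic.nonempty_iso_top (hconn : G.Connected) (h3 : IsCubic G) {a b c d : V}
    (hab : G.Adj a b) (hac : G.Adj a c) (had : G.Adj a d) (hbc : G.Adj b c) (hbd : G.Adj b d)
    (hcd : G.Adj c d) : Nonempty (G ≃g (⊤ : SimpleGraph (Fin 4))) := by
  have h1 := hab.ne
  have h2 := hac.ne
  have h4 := had.ne
  have h5 := hbc.ne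
  have h6 := hbd.ne
  have h7 := hcd.ne
  refine nonempty_iso_of_closed hconn ![a, b, c, d] (injective_vecCons_four h1 h2 h4 h5 h6 h7) ?_ ?_
  · intro i j
    fin_cases i <;> fin_cases j <;> simp [*, G.adj_comm]
  · intro i v hv
    have key : ∀ v, v ∈ Set.range ![a, b, c, d] ↔ v = a ∨ v = b ∨ v = c ∨ v = d := by
      intro v; simp; tauto
    rw [key]
    fin_cases i
    · have := h3.eq_or_eq_or_eq hab hac had h5 h6 h7 hv; tauto
    · have := h3.eq_or_eq_or_eq hab.symm hbc hbd h2 h4 h7 hv; tauto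
    · have := h3.eq_or_eq_or_eq hac.symm hbc.symm hcd h1 h4 h6 hv; tauto
    · have := h3.eq_or_eq_or_eq had.symm hbd.symm hcd.symm h1 h2 h5 hv; tauto

theorem IsCubic.nonempty_iso_completeBipartiteGraph (hconn : G.Connected) (h3 : IsCubic G)
    (htri : ∀ u v w, G.Adj u v → G.Adj v w → ¬ G.Adj u w) {a b : Fin 3 → V}
    (ha : Function.Injective a) (hb : Function.Injective b) (hab : ∀ i j, G.Adj (a i) (b j)) :
    Nonempty (G ≃g completeBipartiteGraph (Fin 3) (Fin 3)) := by
  have hN : ∀ (u : V) (p : Fin 3 → V), Function.Injective p → (∀ i, G.Adj u (p i)) → ∀ v,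
      G.Adj u v → ∃ i, p i = v := by
    intro u p hp hu v hv
    rcases h3.eq_or_eq_or_eq (hu 0) (hu 1) (hu 2) (hp.ne (by decide)) (hp.ne (by decide))
      (hp.ne (by decide)) hv with h | h | h <;> exact ⟨_, h.symm⟩
  refine nonempty_iso_of_closed hconn (Sum.elim a b) ?_ ?_ ?_
  · exact ha.sumElim hb fun i j => (hab i j).ne
  · rintro (i | i) (j | j)
    · simpa using fun h => htri _ _ _ h (hab j 0) (hab i 0)
    · simpa using hab i j
    · simpa using (hab j i).symm
    · simpa using fun h => htri _ _ _ (hab 0 i) h (hab 0 j)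
  · rintro (i | i) v hv
    · obtain ⟨j, rfl⟩ := hN _ b hb (hab i) v hv
      exact ⟨Sum.inr j, rfl⟩
    · obtain ⟨j, rfl⟩ := hN _ a ha (fun j => (hab j i).symm) v hv
      exact ⟨Sum.inl j, rfl⟩

theorem hasDistinguishingEdgeColoring_of_triangle (hconn : G.Connected) (h3 : IsCubic G)
    (hdia : ¬ ∃ a b c x, G.Adj a b ∧ G.Adj a c ∧ G.Adj b c ∧ G.Adj a x ∧ G.Adj b x ∧ c ≠ x)
    {a b c : V} (hab : G.Adj a b) (hbc : G.Adj b c) (hac : G.Adj a c) :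
    HasDistinguishingEdgeColoring G 2 := by
  let p : Fin 3 → V := ![a, b, c]
  have hinj : Function.Injective p := injective_vecCons_three hab.ne hac.ne hbc.ne
  have hadj : ∀ i j, G.Adj (p i) (p j) ↔ j = i + 1 ∨ i = j + 1 := by
    intro i j
    fin_cases i <;> fin_cases j <;> simp [p, hab, hbc, hac, hab.symm, hbc.symm, hac.symm]
  have hout : ∀ x ∉ Set.range p, ∀ i j, G.Adj x (p i) → G.Adj x (p j) → i = j := by
    intro x hx i j hi hj
    by_contra hij
    have hthird : ∀ i j : Fin 3, ∃ k, k ≠ i ∧ k ≠ j := by decide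
    have hpair : ∀ k l : Fin 3, k ≠ l → l = k + 1 ∨ k = l + 1 := by decide
    obtain ⟨k, hki, hkj⟩ := hthird i j
    have hpp : ∀ {k l}, k ≠ l → G.Adj (p k) (p l) := fun h => (hadj _ _).2 (hpair _ _ h)
    exact hdia ⟨p i, p j, p k, x, hpp hij, hpp hki.symm, hpp hkj.symm, hi.symm, hj.symm,
      fun h => hx ⟨k, h⟩⟩
  exact hasDistinguishingEdgeColoring_of_inducedCycle (n := 3) hconn h3 (by norm_num)
    (by norm_num) p hinj hadj hout

theorem hasDistinguishingEdgeColoring_of_quadrilateral (hconn : G.Connected) (h3 : IsCubic G)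
    (htri : ∀ u v w, G.Adj u v → G.Adj v w → ¬ G.Adj u w)
    (hK : ¬ ∃ a b x y z, a ≠ b ∧ x ≠ y ∧ x ≠ z ∧ y ≠ z ∧ G.Adj a x ∧ G.Adj a y ∧ G.Adj a z ∧
      G.Adj b x ∧ G.Adj b y ∧ G.Adj b z)
    {a b c d : V} (hab : G.Adj a b) (hbc : G.Adj b c) (hcd : G.Adj c d) (hda : G.Adj d a)
    (hac : a ≠ c) (hbd : b ≠ d) : HasDistinguishingEdgeColoring G 2 := by
  have h6 : ¬ G.Adj a c := htri _ _ _ hab hbc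
  have h7 : ¬ G.Adj b d := htri _ _ _ hbc hcd
  have h6' : ¬ G.Adj c a := fun h => h6 h.symm
  have h7' : ¬ G.Adj d b := fun h => h7 h.symm
  let p : Fin 4 → V := ![a, b, c, d]
  have hinj : Function.Injective p :=
    injective_vecCons_four hab.ne hac hda.ne' hbc.ne hbd hcd.ne
  have hadj : ∀ i j, G.Adj (p i) (p j) ↔ j = i + 1 ∨ i = j + 1 := by
    intro i j
    fin_cases i <;> fin_cases j <;> simp [p, hab, hbc, hcd, hda, hab.symm, hbc.symm, hcd.symm,
      hda.symm, h6, h7, h6', h7']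
  have hout : ∀ x ∉ Set.range p, ∀ i j, G.Adj x (p i) → G.Adj x (p j) → i = j := by
    intro x hx i j hi hj
    by_contra hij
    have hcases : ∀ i j : Fin 4, i ≠ j →
        (j = i + 1 ∨ i = j + 1) ∨ i + 1 ≠ j + 1 ∧ j = i + 1 + 1 ∧ i = j + 1 + 1 := by decide
    rcases hcases i j hij with h | ⟨hne, hji, hij'⟩
    · exact htri _ _ _ hi ((hadj i j).2 h) hj
    · exact hK ⟨p i, p j, p (i + 1), p (j + 1), x, hinj.ne hij, hinj.ne hne,
        fun h => hx ⟨_, h⟩, fun h => hx ⟨_, h⟩, (hadj _ _).2 (Or.inl rfl),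
        (hadj _ _).2 (Or.inr hij'), hi.symm, (hadj _ _).2 (Or.inr hji),
        (hadj _ _).2 (Or.inl rfl), hj.symm⟩
  exact hasDistinguishingEdgeColoring_of_inducedCycle (n := 4) hconn h3 (by norm_num)
    (by norm_num) p hinj hadj hout

theorem hasDistinguishingEdgeColoring_of_isCubic (hconn : G.Connected) (h3 : IsCubic G)
    (hK4 : IsEmpty (G ≃g (⊤ : SimpleGraph (Fin 4))))
    (hK33 : IsEmpty (G ≃g completeBipartiteGraph (Fin 3) (Fin 3))) :
    HasDistinguishingEdgeColoring G 2 := by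
  by_cases hdia : ∃ a b c x, G.Adj a b ∧ G.Adj a c ∧ G.Adj b c ∧ G.Adj a x ∧ G.Adj b x ∧ c ≠ x
  · obtain ⟨a, b, c, x, hab, hac, hbc, hax, hbx, hcx⟩ := hdia
    by_cases hadj : G.Adj c x
    · exact (not_nonempty_iff.2 hK4 (h3.nonempty_iso_top hconn hab hac hax hbc hbx hadj)).elim
    · exact hasDistinguishingEdgeColoring_of_diamond hconn h3 hab hac hbc hax hbx hcx hadj
  by_cases htri : ∃ a b c, G.Adj a b ∧ G.Adj b c ∧ G.Adj a c
  · obtain ⟨a, b, c, hab, hbc, hac⟩ := htri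
    exact hasDistinguishingEdgeColoring_of_triangle hconn h3 hdia hab hbc hac
  replace htri : ∀ u v w, G.Adj u v → G.Adj v w → ¬ G.Adj u w :=
    fun u v w h1 h2 h4 => htri ⟨u, v, w, h1, h2, h4⟩
  by_cases hK : ∃ a b x y z, a ≠ b ∧ x ≠ y ∧ x ≠ z ∧ y ≠ z ∧ G.Adj a x ∧ G.Adj a y ∧ G.Adj a z ∧
      G.Adj b x ∧ G.Adj b y ∧ G.Adj b z
  · obtain ⟨a, b, x, y, z, hab, hxy, hxz, hyz, hax, hay, haz, hbx, hby, hbz⟩ := hK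
    refine hasDistinguishingEdgeColoring_of_completeBipartite hconn h3 htri hab hxy hxz hyz hax hay
      haz hbx hby hbz fun w hwx hwy hwz => ?_
    by_contra! hw
    refine not_nonempty_iff.2 hK33 (h3.nonempty_iso_completeBipartiteGraph hconn htri
      (injective_vecCons_three hab hw.1.symm hw.2.symm) (injective_vecCons_three hxy hxz hyz) ?_)
    intro i j
    fin_cases i <;> fin_cases j <;> assumption
  by_cases hquad : ∃ a b c d, G.Adj a b ∧ G.Adj b c ∧ G.Adj c d ∧ G.Adj d a ∧ a ≠ c ∧ b ≠ d
  · obtain ⟨a, b, c, d, hab, hbc, hcd, hda, hac, hbd⟩ := hquad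
    exact hasDistinguishingEdgeColoring_of_quadrilateral hconn h3 htri hK hab hbc hcd hda hac hbd
  by_cases hclosed : ∃ n, HasClosedWalk G n
  · refine hasDistinguishingEdgeColoring_of_hasClosedWalk hconn h3 htri ?_ hclosed
    intro u v w x huv hvw hwx hxu
    by_contra! h
    exact hquad ⟨u, v, w, x, huv, hvw, hwx, hxu, h.1, h.2⟩
  · exact hasDistinguishingEdgeColoring_of_not_hasClosedWalk hconn h3 (not_exists.1 hclosed)

/-- Every vertex has exactly two neighbours. -/
def IsTwoRegular (G : SimpleGraph V) : Prop :=
  ∀ v, ∃ a b, a ≠ b ∧ ∀ w, G.Adj v w ↔ w = a ∨ w = b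

theorem IsTwoRegular.eq_or_eq (h : IsTwoRegular G) {v a b c : V} (ha : G.Adj v a)
    (hb : G.Adj v b) (hab : a ≠ b) (hc : G.Adj v c) : c = a ∨ c = b := by
  obtain ⟨x, y, -, hw⟩ := h v
  rw [hw] at ha hb hc
  grind

theorem IsTwoRegular.exists_adj_ne (h : IsTwoRegular G) (v a : V) : ∃ b, G.Adj v b ∧ b ≠ a := by
  obtain ⟨x, y, hxy, hw⟩ := h v
  by_cases hx : x = a
  · exact ⟨y, (hw y).2 (by simp), fun hy => hxy (hx.trans hy.symm)⟩
  · exact ⟨x, (hw x).2 (by simp), hx⟩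

theorem IsTwoRegular.nonempty_iso_cycleGraph (hconn : G.Connected) (h2 : IsTwoRegular G) {n : ℕ}
    (f : Fin (n + 3) → V) (hinj : Function.Injective f)
    (hadj : ∀ i, G.Adj (f i) (f (i + 1))) : Nonempty (G ≃g cycleGraph (n + 3)) := by
  have hN : ∀ i v, G.Adj (f i) v → v = f (i + 1) ∨ v = f (i - 1) := by
    intro i v hv
    have h1 := (hadj (i - 1)).symm
    rw [sub_add_cancel] at h1
    refine h2.eq_or_eq (hadj i) h1 (hinj.ne fun h => ?_) hv
    have h3 : (1 : Fin (n + 3)) + 1 = 0 := by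
      have := congrArg (fun x => x - i + 1) h
      simpa [add_comm, sub_eq_add_neg, add_left_comm] using this
    have h4 := congrArg Fin.val h3
    rw [Fin.val_add] at h4
    simp [Nat.mod_eq_of_lt (show 2 < n + 3 by omega)] at h4
  refine nonempty_iso_of_closed hconn f hinj (fun i j => ?_) fun i v hv => ?_
  · rw [cycleGraph_adj]
    constructor
    · intro h
      rcases hN i _ h with h | h
      · right; rw [hinj h]; simp
      · left; rw [hinj h]; simp
    · rintro (h | h)
      · obtain rfl : i = j + 1 := by rw [← h]; abel
        exact (hadj j).symm
      · obtain rfl : j = i + 1 := by rw [← h]; abel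
        exact hadj i
  · rcases hN i v hv with h | h <;> exact ⟨_, h.symm⟩

theorem hasDistinguishingEdgeColoring_of_isTwoRegular (hconn : G.Connected) (h2 : IsTwoRegular G)
    (hC3 : IsEmpty (G ≃g cycleGraph 3)) (hC4 : IsEmpty (G ≃g cycleGraph 4))
    (hC5 : IsEmpty (G ≃g cycleGraph 5)) : HasDistinguishingEdgeColoring G 2 := by
  obtain ⟨b⟩ := hconn.nonempty
  obtain ⟨a, hba, -⟩ := h2.exists_adj_ne b b
  obtain ⟨c, hbc, hca⟩ := h2.exists_adj_ne b a
  obtain ⟨d, hcd, hdb⟩ := h2.exists_adj_ne c b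
  obtain ⟨e, hde, hec⟩ := h2.exists_adj_ne d c
  obtain ⟨u, hau, hub⟩ := h2.exists_adj_ne a b
  have hab := hba.ne'
  have hbc' := hbc.ne
  have hcd' := hcd.ne
  have hde' := hde.ne
  have hau' := hau.ne
  have hda : d ≠ a := by
    rintro rfl
    refine not_nonempty_iff.2 hC3 (h2.nonempty_iso_cycleGraph hconn ![d, b, c] ?_ ?_)
    · intro i j hij
      fin_cases i <;> fin_cases j <;> simp_all
    · intro i
      fin_cases i <;> simp [*, G.adj_comm]
  have hNb := fun v hv => h2.eq_or_eq (c := v) hba hbc hca.symm hv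
  have hNc := fun v hv => h2.eq_or_eq (c := v) hbc.symm hcd hdb.symm hv
  have hNd := fun v hv => h2.eq_or_eq (c := v) hcd.symm hde hec.symm hv
  have hNa := fun v hv => h2.eq_or_eq (c := v) hba.symm hau hub.symm hv
  have heb : e ≠ b := by
    rintro rfl
    rcases hNb d hde.symm with h | h
    · exact hda h
    · exact hcd' h.symm
  have hea : e ≠ a := by
    rintro rfl
    refine not_nonempty_iff.2 hC4 (h2.nonempty_iso_cycleGraph hconn ![e, b, c, d] ?_ ?_)
    · intro i j hij
      fin_cases i <;> fin_cases j <;> simp_all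
    · intro i
      fin_cases i <;> simp [*, G.adj_comm]
  have huc : u ≠ c := by
    rintro rfl
    rcases hNc a hau.symm with h | h
    · exact hab h
    · exact hda h.symm
  have hud : u ≠ d := by
    rintro rfl
    rcases hNd a hau.symm with h | h
    · exact hca h.symm
    · exact hea h.symm
  have hue : u ≠ e := by
    rintro rfl
    refine not_nonempty_iff.2 hC5 (h2.nonempty_iso_cycleGraph hconn ![a, b, c, d, u] ?_ ?_)
    · intro i j hij
      fin_cases i <;> fin_cases j <;> simp_all
    · intro i
      fin_cases i <;> simp [*, G.adj_comm]
  -- the red edges are `ab`, `bc` and `de`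
  let r : V → V → Prop := fun x y => (x = b ∨ y = b) ∨ (x = d ∧ y = e) ∨ (x = e ∧ y = d)
  refine hasDistinguishingEdgeColoring_two_of_red r
    (fun x y h => by simp only [r] at h ⊢; tauto) fun φ hφ => ?_
  have hφb : φ b = b := by
    have hall : ∀ y, G.Adj (φ b) y → r (φ b) y := by
      intro y hy
      obtain ⟨y, rfl⟩ := φ.surjective y
      exact (hφ _ _ (φ.map_adj_iff.1 hy)).2 (Or.inl (Or.inl rfl))
    by_contra hne
    have hred : ∀ y, G.Adj (φ b) y → y = b ∨ (φ b = d ∧ y = e) ∨ (φ b = e ∧ y = d) := by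
      intro y hy
      have := hall y hy
      simp only [r] at this
      tauto
    -- some neighbour of `φ b` is not `b`, so `φ b` is `d` or `e`
    obtain ⟨y, hy, hyb⟩ := h2.exists_adj_ne (φ b) b
    rcases hred y hy with h | ⟨h, -⟩ | ⟨h, -⟩
    · exact hyb h
    · have := hred c (by rw [h]; exact hcd.symm)
      grind
    · obtain ⟨z, hz, hzd⟩ := h2.exists_adj_ne e d
      rcases hred z (by rw [h]; exact hz) with h' | h' | h'
      · subst h'
        rcases hNb e hz.symm with h' | h'
        · exact hea h'
        · exact hec h'
      · exact hde' (h'.1.symm.trans h)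
      · exact hzd h'.2
  have hφc : φ c = c := by
    have h1 := φ.map_adj_iff.2 hbc
    rw [hφb] at h1
    rcases hNb _ h1 with h | h
    · exfalso
      have h3 := φ.map_adj_iff.2 hcd
      have h4 := φ.map_adj_iff.2 hde
      have h5 := (hφ _ _ hde).2 (by simp [r])
      rw [h] at h3
      rcases hNa _ h3 with h6 | h6
      · exact hdb (φ.injective (h6.trans hφb.symm))
      · have h7 : φ e ≠ b := fun h => heb (φ.injective (h.trans hφb.symm))
        rw [h6] at h5
        simp only [r] at h5
        tauto
    · exact h
  have key : ∀ x y z, φ x = x → G.Adj x y → φ y = y → G.Adj y z → φ z = z := by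
    intro x y z hx hxy hy hyz
    by_cases hzx : z = x
    · rw [hzx, hx]
    · have h1 := φ.map_adj_iff.2 hyz
      rw [hy] at h1
      rcases h2.eq_or_eq hxy.symm hyz (Ne.symm hzx) h1 with h | h
      · exact absurd (φ.injective (h.trans hx.symm)) hzx
      · exact h
  have hall := hconn.forall_of_adj (P := fun v => φ v = v ∧ ∀ w, G.Adj v w → φ w = w) (v₀ := b)
    ⟨hφb, fun w hw => key c b w hφc hbc.symm hφb hw⟩
    fun x y hxy hx => ⟨hx.2 y hxy, fun w hw => key x y w hx.1 hxy (hx.2 y hxy) hw⟩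
  exact fun v => (hall v).1

theorem SimpleGraph.IsRegularOfDegree.isTwoRegular [G.LocallyFinite]
    (h : G.IsRegularOfDegree 2) : IsTwoRegular G := by
  classical
  intro v
  obtain ⟨a, b, hab, hs⟩ := Finset.card_eq_two.1 (h v)
  exact ⟨a, b, hab, fun w => by rw [← mem_neighborFinset, hs]; simp⟩

theorem SimpleGraph.IsRegularOfDegree.isCubic [G.LocallyFinite]
    (h : G.IsRegularOfDegree 3) : IsCubic G := by
  classical
  intro v
  obtain ⟨a, b, c, hab, hac, hbc, hs⟩ := Finset.card_eq_three.1 (h v)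
  exact ⟨a, b, c, hab, hac, hbc, fun w => by rw [← mem_neighborFinset, hs]; simp⟩

end

/-- A connected simple graph which is 2-regular or 3-regular and not isomorphic to any of
`C_3`, `C_4`, `C_5`, `K_4`, `K_{3,3}` admits a distinguishing edge colouring with two
colours. -/
theorem stmt_9 {V : Type*} (G : SimpleGraph V) [G.LocallyFinite]
    (hconn : G.Connected)
    (hreg : G.IsRegularOfDegree 2 ∨ G.IsRegularOfDegree 3)
    (hC3 : IsEmpty (G ≃g cycleGraph 3))
    (hC4 : IsEmpty (G ≃g cycleGraph 4))
    (hC5 : IsEmpty (G ≃g cycleGraph 5))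
    (hK4 : IsEmpty (G ≃g (⊤ : SimpleGraph (Fin 4))))
    (hK33 : IsEmpty (G ≃g completeBipartiteGraph (Fin 3) (Fin 3))) :
    HasDistinguishingEdgeColoring G 2 := by
  rcases hreg with h | h
  · exact hasDistinguishingEdgeColoring_of_isTwoRegular hconn h.isTwoRegular hC3 hC4 hC5
  · exact hasDistinguishingEdgeColoring_of_isCubic hconn h.isCubic hK4 hK33
end

section
/- For every natural number n ≥ 6, the complete graph K_n admits a distinguishing edge colouring with 2 colours; that is, there is a function from the edge set of K_n to a two-element set of colours such that the only permutation of the n vertices preserving the colouring is the identity. -/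
open SimpleGraph

/-- The graph on `Fin n` formed by the path `1 - 2 - ⋯ - (n - 1)` together with the edge `1 - 3`
and the pendant edge `0 - 2`. -/
def asymmetricGraph (n : ℕ) : SimpleGraph (Fin n) :=
  SimpleGraph.fromRel fun i j =>
    (1 ≤ i.val ∧ j.val = i.val + 1) ∨ (i.val = 1 ∧ j.val = 3) ∨ (i.val = 0 ∧ j.val = 2)

theorem asymmetricGraph_adj {n : ℕ} (i j : Fin n) :
    (asymmetricGraph n).Adj i j ↔
      (1 ≤ i.val ∧ j.val = i.val + 1) ∨ (1 ≤ j.val ∧ i.val = j.val + 1) ∨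
      (i.val = 1 ∧ j.val = 3) ∨ (i.val = 3 ∧ j.val = 1) ∨
      (i.val = 0 ∧ j.val = 2) ∨ (i.val = 2 ∧ j.val = 0) := by
  simp only [asymmetricGraph, SimpleGraph.fromRel_adj, ne_eq, Fin.ext_iff]
  omega

/-- For `n ≥ 6`, the only injective endomorphism of `asymmetricGraph n` is the identity. -/
theorem asymmetricGraph_eq_of_injective {n : ℕ} (hn : 6 ≤ n) {f : Fin n → Fin n}
    (hf : Function.Injective f)
    (hadj : ∀ i j, (asymmetricGraph n).Adj i j → (asymmetricGraph n).Adj (f i) (f j))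
    (v : Fin n) : f v = v := by
  have hne : ∀ i j (hi : i < n) (hj : j < n), i ≠ j → (f ⟨i, hi⟩).val ≠ (f ⟨j, hj⟩).val := by
    intro i j hi hj hij h
    exact hij (congrArg Fin.val (hf (Fin.ext h)))
  simp only [asymmetricGraph_adj] at hadj
  have hsmall : (f ⟨0, by omega⟩).val = 0 ∧ (f ⟨1, by omega⟩).val = 1 ∧
      (f ⟨2, by omega⟩).val = 2 ∧ (f ⟨3, by omega⟩).val = 3 := by
    have h12 := hadj ⟨1, by omega⟩ ⟨2, by omega⟩ (by simp)
    have h13 := hadj ⟨1, by omega⟩ ⟨3, by omega⟩ (by simp)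
    have h23 := hadj ⟨2, by omega⟩ ⟨3, by omega⟩ (by simp)
    have h02 := hadj ⟨0, by omega⟩ ⟨2, by omega⟩ (by simp)
    have h34 := hadj ⟨3, by omega⟩ ⟨4, by omega⟩ (by simp)
    have h45 := hadj ⟨4, by omega⟩ ⟨5, by omega⟩ (by simp)
    have n01 := hne 0 1 (by omega) (by omega) (by omega)
    have n03 := hne 0 3 (by omega) (by omega) (by omega)
    have n14 := hne 1 4 (by omega) (by omega) (by omega)
    have n24 := hne 2 4 (by omega) (by omega) (by omega)
    have n35 := hne 3 5 (by omega) (by omega) (by omega)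
    generalize (f ⟨0, _⟩).val = a0 at *
    generalize (f ⟨1, _⟩).val = a1 at *
    generalize (f ⟨2, _⟩).val = a2 at *
    generalize (f ⟨3, _⟩).val = a3 at *
    generalize (f ⟨4, _⟩).val = a4 at *
    generalize (f ⟨5, _⟩).val = a5 at *
    have triangle : (a1 = 1 ∨ a1 = 2 ∨ a1 = 3) ∧ (a2 = 1 ∨ a2 = 2 ∨ a2 = 3) ∧
        (a3 = 1 ∨ a3 = 2 ∨ a3 = 3) := by omega
    obtain ⟨rfl | rfl | rfl, rfl | rfl | rfl, rfl | rfl | rfl⟩ := triangle <;> omega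
  obtain ⟨h0, h1, h2, h3⟩ := hsmall
  have hall : ∀ k (hk : k < n), (f ⟨k, hk⟩).val = k := by
    intro k
    induction k using Nat.strong_induction_on with
    | _ k ih =>
      intro hk
      by_cases hk3 : k ≤ 3
      · interval_cases k <;> assumption
      · have hpred := ih (k - 1) (by omega) (by omega)
        have hedge := hadj ⟨k - 1, by omega⟩ ⟨k, hk⟩ (by simp only; omega)
        rw [hpred] at hedge
        have hpred2 := ih (k - 2) (by omega) (by omega)
        have m1 := hne k 1 hk (by omega) (by omega)
        have m2 := hne k (k - 2) hk (by omega) (by omega)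
        omega
  exact Fin.ext (hall v.val v.isLt)

/-- For every `n ≥ 6`, the complete graph `K_n` admits a distinguishing edge colouring with
two colours. -/
theorem stmt_10 (n : ℕ) (hn : 6 ≤ n) :
    HasDistinguishingEdgeColoring (⊤ : SimpleGraph (Fin n)) 2 := by
  classical
  refine ⟨fun e => if e.val ∈ (asymmetricGraph n).edgeSet then 1 else 0, fun φ hφ => ?_⟩
  refine asymmetricGraph_eq_of_injective hn φ.injective fun i j hij => ?_
  have h := hφ ⟨s(i, j), hij.ne⟩
  simpa [hij] using h
end

section
/- For every natural number n ≥ 4, the complete bipartite graph K_{n,n} admits a distinguishing edge colouring with 2 colours. -/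
open SimpleGraph

/-- The staircase `j ≤ i` with row `1` replaced by `{1, 3}`. -/
def Staircase (i j : ℕ) : Prop :=
  (i = 0 ∧ j = 0) ∨ (i = 1 ∧ (j = 1 ∨ j = 3)) ∨ (2 ≤ i ∧ j ≤ i)

namespace Staircase

open Classical in
theorem card_row {n : ℕ} (hn : 4 ≤ n) (i : Fin n) :
    (Finset.univ.filter fun j : Fin n => Staircase i j).card = i + 1 := by
  obtain h | h | h : i.val = 0 ∨ i.val = 1 ∨ 2 ≤ i.val := by omega
  · rw [h, Finset.card_eq_one]
    refine ⟨⟨0, by omega⟩, ?_⟩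
    ext j
    simp [Staircase, Fin.ext_iff]
  · rw [h, Finset.card_eq_two]
    refine ⟨⟨1, by omega⟩, ⟨3, by omega⟩, by simp, ?_⟩
    ext j
    simp [Staircase, Fin.ext_iff]
  · rw [← Fin.card_Iic i]
    refine congrArg Finset.card (Finset.ext fun j => ?_)
    rw [Finset.mem_filter_univ, Finset.mem_Iic, Fin.le_def, Staircase]
    omega

theorem exists_not_column {n : ℕ} (hn : 4 ≤ n) (j : Fin n) : ∃ i : Fin n, ¬ Staircase i j := by
  by_cases h : j.val = 0
  · exact ⟨⟨1, by omega⟩, by simp [Staircase, h]⟩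
  · exact ⟨⟨0, by omega⟩, by simp [Staircase, h]⟩

theorem exists_separating_row {n : ℕ} {j k : Fin n} (h : j < k) :
    ∃ i : Fin n, Staircase i j ∧ ¬ Staircase i k := by
  have hk := k.isLt
  rw [Fin.lt_def] at h
  by_cases h3 : 3 ≤ k.val
  · refine ⟨⟨k - 1, by omega⟩, ?_⟩
    simp only [Staircase]
    omega
  · refine ⟨j, ?_⟩
    simp only [Staircase]
    omega

theorem column_injective {n : ℕ} {j k : Fin n}
    (h : ∀ i : Fin n, Staircase i j ↔ Staircase i k) : j = k := by
  rcases lt_trichotomy j k with hlt | heq | hlt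
  · obtain ⟨i, hj, hk⟩ := exists_separating_row hlt
    exact absurd ((h i).1 hj) hk
  · exact heq
  · obtain ⟨i, hk, hj⟩ := exists_separating_row hlt
    exact absurd ((h i).2 hk) hj

/-- The staircase has no nontrivial symmetry preserving rows and columns. -/
theorem rigid {n : ℕ} (hn : 4 ≤ n) {σ τ : Fin n → Fin n} (hτ : Function.Injective τ)
    (h : ∀ i j, Staircase (σ i) (τ j) ↔ Staircase i j) : (∀ i, σ i = i) ∧ ∀ j, τ j = j := by
  classical
  have hσ : ∀ i, σ i = i := by
    intro i
    have hcard := Finset.card_bijective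
      (s := Finset.univ.filter fun j : Fin n => Staircase i j)
      (t := Finset.univ.filter fun j : Fin n => Staircase (σ i) j)
      τ (Finite.injective_iff_bijective.1 hτ) (by simp [h])
    rw [card_row hn, card_row hn] at hcard
    exact Fin.ext (by omega)
  refine ⟨hσ, fun j => column_injective fun i => ?_⟩
  simpa [hσ] using h i j

end Staircase

open Classical in
/-- The edge colouring of `K_{n,n}` whose edges of colour `1` are the cells of the staircase. -/
noncomputable def staircaseColoring (n : ℕ)
    (e : (completeBipartiteGraph (Fin n) (Fin n)).edgeSet) : Fin 2 :=
  if ∃ i j : Fin n, Staircase i j ∧ e.val = s(Sum.inl i, Sum.inr j) then 1 else 0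

theorem staircaseColoring_eq_one_iff {n : ℕ}
    (e : (completeBipartiteGraph (Fin n) (Fin n)).edgeSet) :
    staircaseColoring n e = 1 ↔
      ∃ i j : Fin n, Staircase i j ∧ e.val = s(Sum.inl i, Sum.inr j) := by
  unfold staircaseColoring
  split_ifs with h <;> simp [h]

/-- For every `n ≥ 4`, the complete bipartite graph `K_{n,n}` admits a distinguishing edge
colouring with two colours. -/
theorem stmt_11 (n : ℕ) (hn : 4 ≤ n) :
    HasDistinguishingEdgeColoring (completeBipartiteGraph (Fin n) (Fin n)) 2 := by
  refine ⟨staircaseColoring n, fun φ hφ => ?_⟩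
  have hadj (v w) : (completeBipartiteGraph (Fin n) (Fin n)).Adj (φ v) (φ w) ↔
      (completeBipartiteGraph (Fin n) (Fin n)).Adj v w := φ.map_adj_iff
  have hcell (i j : Fin n) : Staircase i j ↔
      ∃ k l : Fin n, Staircase k l ∧
        s(φ (Sum.inl i), φ (Sum.inr j)) = s(Sum.inl k, Sum.inr l) := by
    have he : s(Sum.inl i, Sum.inr j) ∈ (completeBipartiteGraph (Fin n) (Fin n)).edgeSet := by
      simp
    have h := congrArg (· = 1) (hφ ⟨_, he⟩)
    simp only [staircaseColoring_eq_one_iff, eq_iff_iff] at h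
    refine Iff.trans ?_ h.symm
    simp
  -- Row `n - 1` is full and no column is, so `φ` cannot exchange the two parts.
  obtain ⟨k, hk⟩ : ∃ k, φ (Sum.inl ⟨n - 1, by omega⟩) = Sum.inl k := by
    rcases hL : φ (Sum.inl ⟨n - 1, by omega⟩) with k | k
    · exact ⟨k, rfl⟩
    · obtain ⟨m, hm⟩ := Staircase.exists_not_column hn k
      obtain ⟨w, hw⟩ := φ.surjective (Sum.inl m)
      have hLw := hadj (Sum.inl ⟨n - 1, by omega⟩) w
      rw [hL, hw] at hLw
      rcases w with w | w
      · simp at hLw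
      · have hfull : Staircase (n - 1) w := Or.inr (Or.inr (by omega))
        obtain ⟨a, b, hab, heq⟩ := (hcell ⟨n - 1, by omega⟩ w).1 hfull
        rw [hL, hw] at heq
        simp at heq
        obtain ⟨rfl, rfl⟩ := heq
        exact absurd hab hm
  have hright (j : Fin n) : ∃ l, φ (Sum.inr j) = Sum.inr l := by
    have h := hadj (Sum.inl ⟨n - 1, by omega⟩) (Sum.inr j)
    rw [hk] at h
    simpa [Sum.isRight_iff] using h
  choose τ hτ using hright
  have hleft (i : Fin n) : ∃ l, φ (Sum.inl i) = Sum.inl l := by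
    have h := hadj (Sum.inl i) (Sum.inr ⟨0, by omega⟩)
    rw [hτ] at h
    simpa [Sum.isLeft_iff] using h
  choose σ hσ using hleft
  have hinj : Function.Injective τ := fun a b hab =>
    Sum.inr_injective (φ.injective (by rw [hτ, hτ, hab]))
  obtain ⟨h₁, h₂⟩ := Staircase.rigid hn (σ := σ) hinj fun i j => by
    rw [hcell i j, hσ, hτ]
    simp
  rintro (i | j)
  · rw [hσ, h₁]
  · rw [hτ, h₂]
end

section
/- Let G be a finite connected simple graph with at least 7 vertices that contains a Hamiltonian path (a path visiting every vertex exactly once). Then G admits a distinguishing edge colouring with 2 colours. -/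
open SimpleGraph

/-- If every automorphism of `G` preserving a spanning subgraph `H` is trivial, then colouring
the edges of `H` with one colour and the remaining edges with another is distinguishing. -/
theorem hasDistinguishingEdgeColoring_of_le {V : Type*} {G H : SimpleGraph V} (hle : H ≤ G)
    (h : ∀ φ : G ≃g G, (∀ u v, H.Adj (φ u) (φ v) ↔ H.Adj u v) → ∀ v, φ v = v) :
    HasDistinguishingEdgeColoring G 2 := by
  classical
  refine ⟨fun e => if e.1 ∈ H.edgeSet then 1 else 0, fun φ hφ => h φ fun u v => ?_⟩
  by_cases huv : G.Adj u v
  · have := hφ ⟨s(u, v), huv⟩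
    simp only [Iso.mapEdgeSet, Hom.mapEdgeSet, Equiv.coe_fn_mk, Sym2.map_mk, mem_edgeSet] at this
    by_cases h₁ : H.Adj u v <;> by_cases h₂ : H.Adj (φ u) (φ v) <;> simp_all
  · exact iff_of_false (fun h' => huv (φ.map_adj_iff.1 (hle h'))) fun h' => huv (hle h')

/-- A pair of mutually inverse permutations `f`, `g` of the natural numbers below `n`, of which
`f` preserves the relation `r`. -/
structure IsRelPerm (n : ℕ) (r : ℕ → ℕ → Prop) (f g : ℕ → ℕ) : Prop where
  lt : ∀ i < n, f i < n
  inv_lt : ∀ i < n, g i < n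
  left_inv : ∀ i < n, g (f i) = i
  right_inv : ∀ i < n, f (g i) = i
  rel : ∀ i < n, ∀ j < n, (r (f i) (f j) ↔ r i j)

theorem IsRelPerm.injOn {n : ℕ} {r : ℕ → ℕ → Prop} {f g : ℕ → ℕ} (h : IsRelPerm n r f g)
    {i j : ℕ} (hi : i < n) (hj : j < n) (hij : f i = f j) : i = j := by
  rw [← h.left_inv i hi, hij, h.left_inv j hj]

/-- If `f` fixes an initial segment, and each later `i + 1` is the only neighbour of `i`
not yet known to be fixed, then `f` is the identity. -/
theorem IsRelPerm.eq_self {n k : ℕ} {r : ℕ → ℕ → Prop} {f g : ℕ → ℕ} (h : IsRelPerm n r f g)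
    (hk : ∀ i ≤ k, i < n → f i = i) (hr : ∀ i, k ≤ i → i + 1 < n → r i (i + 1) ∨ f (i + 1) = i + 1)
    (hr' : ∀ i j, k ≤ i → i < n → j < n → r i j → j ≤ i + 1 ∨ f j = j) :
    ∀ i < n, f i = i := by
  intro i
  induction i using Nat.strong_induction_on with
  | _ i ih =>
    intro hi
    by_cases hik : i ≤ k
    · exact hk i hik hi
    · obtain ⟨m, rfl⟩ : ∃ m, i = m + 1 := ⟨i - 1, by omega⟩
      have hm := ih m (by omega) (by omega)
      by_contra hne
      have hrel := (h.rel m (by omega) (m + 1) hi).2 ((hr m (by omega) hi).resolve_right hne)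
      rw [hm] at hrel
      have hlt := h.lt _ hi
      have hfix : f (f (m + 1)) = f (m + 1) := by
        rcases hr' m _ (by omega) (by omega) hlt hrel with h' | h'
        · exact ih _ (by omega) hlt
        · exact h'
      exact hne (h.injOn hlt hi hfix)

/-- The relation on indices induced by a graph whose vertices are enumerated by `p`. -/
def indexAdj {V : Type*} (G : SimpleGraph V) {n : ℕ} (p : Fin n ≃ V) (i j : ℕ) : Prop :=
  ∃ (hi : i < n) (hj : j < n), G.Adj (p ⟨i, hi⟩) (p ⟨j, hj⟩)

theorem indexAdj_comm {V : Type*} {G : SimpleGraph V} {n : ℕ} {p : Fin n ≃ V} {i j : ℕ} :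
    indexAdj G p i j ↔ indexAdj G p j i :=
  ⟨fun ⟨hi, hj, h⟩ => ⟨hj, hi, h.symm⟩, fun ⟨hi, hj, h⟩ => ⟨hj, hi, h.symm⟩⟩

/-- Version of `hasDistinguishingEdgeColoring_of_le` for a graph with enumerated vertices. -/
theorem hasDistinguishingEdgeColoring_of_index {V : Type*} {G : SimpleGraph V} {n : ℕ}
    (p : Fin n ≃ V) (r : ℕ → ℕ → Prop) (hsymm : ∀ i j, r i j → r j i)
    (hle : ∀ i < n, ∀ j < n, r i j → indexAdj G p i j)
    (h : ∀ f g, IsRelPerm n (indexAdj G p) f g → IsRelPerm n r f g → ∀ i < n, f i = i) :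
    HasDistinguishingEdgeColoring G 2 := by
  have hle' : ∀ u v, r (p.symm u) (p.symm v) → G.Adj u v := fun u v huv => by
    obtain ⟨hi, hj, h'⟩ := hle _ (p.symm u).2 _ (p.symm v).2 huv
    simpa using h'
  let H : SimpleGraph V :=
    { Adj := fun u v => r (p.symm u) (p.symm v)
      symm := ⟨fun u v => hsymm _ _⟩
      loopless := ⟨fun u hu => (hle' u u hu).ne rfl⟩ }
  refine hasDistinguishingEdgeColoring_of_le (H := H) (fun u v => hle' u v) fun φ hφ => ?_
  let f : ℕ → ℕ := fun i => if hi : i < n then p.symm (φ (p ⟨i, hi⟩)) else i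
  let g : ℕ → ℕ := fun i => if hi : i < n then p.symm (φ.symm (p ⟨i, hi⟩)) else i
  have key := h f g
    ⟨fun i hi => by simp [f, hi], fun i hi => by simp [g, hi], fun i hi => by simp [f, g, hi],
      fun i hi => by simp [f, g, hi], fun i hi j hj => by
        simpa [f, indexAdj, hi, hj] using φ.map_adj_iff⟩
    ⟨fun i hi => by simp [f, hi], fun i hi => by simp [g, hi], fun i hi => by simp [f, g, hi],
      fun i hi => by simp [f, g, hi], fun i hi j hj => by
        simpa [f, H, hi, hj] using hφ (p ⟨i, hi⟩) (p ⟨j, hj⟩)⟩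
  intro v
  have hv := key _ (p.symm v).2
  simp only [f, Fin.is_lt, dite_true, Fin.eta, Equiv.apply_symm_apply] at hv
  exact p.symm.injective (Fin.ext hv)

/-- A Hamiltonian path with non-adjacent ends yields a distinguishing colouring. -/
theorem hasDistinguishingEdgeColoring_of_not_adj_ends {V : Type*} {G : SimpleGraph V} {n : ℕ}
    (hn : 3 ≤ n) (p : Fin n ≃ V) (hp : ∀ i, i + 1 < n → indexAdj G p i (i + 1))
    (hends : ¬ indexAdj G p 0 (n - 1)) : HasDistinguishingEdgeColoring G 2 := by
  refine hasDistinguishingEdgeColoring_of_index p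
    (fun i j => (j = i + 1 ∨ i = j + 1) ∧ i + 1 < n ∧ j + 1 < n) (by grind) ?_ ?_
  · rintro i hi j hj ⟨rfl | rfl, -, -⟩
    · exact hp _ hj
    · exact indexAdj_comm.1 (hp _ hi)
  · intro f g hG hr
    have hlast : f (n - 1) = n - 1 := by
      by_contra hne
      have := hr.lt (n - 1) (by omega)
      have := hr.right_inv
      have := hr.inv_lt
      have h₁ := hr.rel (n - 1) (by omega)
      rcases Nat.eq_zero_or_pos (f (n - 1)) with h0 | h0
      · have := h₁ (g 1) (hr.inv_lt 1 (by omega))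
        grind
      · have := h₁ (g (f (n - 1) - 1)) (hr.inv_lt _ (by omega))
        grind
    have hfirst : f 0 = 0 := by
      have hlt := hr.lt 0 (by omega)
      have hne : f 0 ≠ n - 1 := fun h' => by
        have := hr.injOn (i := 0) (j := n - 1) (by omega) (by omega) (by omega)
        omega
      by_contra h0
      by_cases h2 : f 0 = n - 2
      · have := hG.rel 0 (by omega) (n - 1) (by omega)
        rw [hlast, h2] at this
        have h3 := hp (n - 2) (by omega)
        rw [show n - 2 + 1 = n - 1 by omega] at h3
        exact hends (this.1 h3)
      · have h₁ := hr.rel 0 (by omega) (g (f 0 - 1)) (hr.inv_lt _ (by omega))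
        have h₂ := hr.rel 0 (by omega) (g (f 0 + 1)) (hr.inv_lt _ (by omega))
        have h₃ := hr.right_inv (f 0 - 1) (by omega)
        have h₄ := hr.right_inv (f 0 + 1) (by omega)
        grind
    refine hr.eq_self (k := 0) ?_ ?_ ?_
    · rintro i hi -
      obtain rfl : i = 0 := by omega
      exact hfirst
    · intro i _ hi
      by_cases h' : i + 2 = n
      · obtain rfl : n = i + 2 := h'.symm
        exact Or.inr hlast
      · omega
    · omega

/-- A Hamiltonian path together with a suitable chord at its second vertex is asymmetric. -/
theorem hasDistinguishingEdgeColoring_of_chord {V : Type*} {G : SimpleGraph V} {n k : ℕ}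
    (p : Fin n ≃ V) (hp : ∀ i, i + 1 < n → indexAdj G p i (i + 1))
    (hk : 3 ≤ k) (hkn : k + 3 ≤ n) (hchord : indexAdj G p 1 k) :
    HasDistinguishingEdgeColoring G 2 := by
  refine hasDistinguishingEdgeColoring_of_index p
    (fun i j => (j = i + 1 ∨ i = j + 1) ∨ (i = 1 ∧ j = k) ∨ (i = k ∧ j = 1)) (by grind) ?_ ?_
  · rintro i hi j hj ((rfl | rfl) | ⟨rfl, rfl⟩ | ⟨rfl, rfl⟩)
    · exact hp _ hj
    · exact indexAdj_comm.1 (hp _ hi)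
    · exact hchord
    · exact indexAdj_comm.1 hchord
  · intro f g hG hr
    have hlt := hr.lt
    have hinj : ∀ i < n, ∀ j < n, f i = f j → i = j := fun i hi j hj => hr.injOn hi hj
    have hend : f 0 = 0 ∨ f 0 = n - 1 := by
      have h0 := hlt 0 (by omega)
      by_contra hne
      have hnbr (m : ℕ) (hm : m < n) (h : m = f 0 + 1 ∨ f 0 = m + 1) : m = f 1 := by
        have h₁ := (hr.rel 0 (by omega) (g m) (hr.inv_lt m hm)).1
          (by rw [hr.right_inv m hm]; exact Or.inl h)
        have h₂ : g m = 1 := by clear hG hinj h hne; omega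
        rw [← h₂, hr.right_inv m hm]
      have h₁ := hnbr (f 0 - 1) (by omega) (by omega)
      have h₂ := hnbr (f 0 + 1) (by omega) (by omega)
      omega
    have hr01 := (hr.rel 0 (by omega) 1 (by omega)).2 (by omega)
    have hr12 := (hr.rel 1 (by omega) 2 (by omega)).2 (by omega)
    have hr1k := (hr.rel 1 (by omega) k (by omega)).2 (by omega)
    have h2k : f 2 ≠ f k := fun h' => absurd (hinj 2 (by omega) k (by omega) h') (by omega)
    have h02 : f 0 ≠ f 2 := fun h' => absurd (hinj 0 (by omega) 2 (by omega) h') (by omega)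
    have h0k : f 0 ≠ f k := fun h' => absurd (hinj 0 (by omega) k (by omega) h') (by omega)
    have h0 : f 0 = 0 := by
      refine hend.resolve_right fun h0 => ?_
      have hl1 := hlt 1 (by omega)
      have h1 : f 1 = n - 2 := by rw [h0] at hr01; clear hr12 hr1k; omega
      rw [h1] at hr12 hr1k
      omega
    have h1 : f 1 = 1 := by rw [h0] at hr01; clear hr12 hr1k; omega
    rw [h1] at hr12 hr1k
    have h2 : f 2 = 2 := by
      by_contra hne
      have hf2 : f 2 = k := by omega
      have hfk : f k = 2 := by omega
      have h₁ := (hr.rel (k - 1) (by omega) k (by omega)).2 (by omega)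
      have h₂ := (hr.rel k (by omega) (k + 1) (by omega)).2 (by omega)
      have h₃ : f (k - 1) ≠ f (k + 1) := fun h' =>
        absurd (hinj (k - 1) (by omega) (k + 1) (by omega) h') (by omega)
      have h₄ : f (k - 1) ≠ f 1 := fun h' =>
        absurd (hinj (k - 1) (by omega) 1 (by omega) h') (by omega)
      have h₅ : f (k + 1) ≠ f 1 := fun h' =>
        absurd (hinj (k + 1) (by omega) 1 (by omega) h') (by omega)
      rw [hfk] at h₁ h₂
      rw [h1] at h₄ h₅
      clear hr12 hr1k hr01
      omega
    have hfk : f k = k := by omega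
    refine hr.eq_self (k := 2) ?_ ?_ ?_
    · intro i hi _
      interval_cases i <;> assumption
    · omega
    · rintro i j hi - - hij
      by_cases hjk : j = k
      · exact Or.inr (hjk ▸ hfk)
      · omega

/-- The cycle on at least six vertices has a distinguishing colouring. -/
theorem hasDistinguishingEdgeColoring_of_cycle {V : Type*} {G : SimpleGraph V} {n : ℕ}
    (hn : 6 ≤ n) (p : Fin n ≃ V)
    (hp : ∀ i < n, ∀ j < n, indexAdj G p i j ↔
      j = i + 1 ∨ i = j + 1 ∨ (i = 0 ∧ j + 1 = n) ∨ (j = 0 ∧ i + 1 = n)) :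
    HasDistinguishingEdgeColoring G 2 := by
  refine hasDistinguishingEdgeColoring_of_index p
    (fun i j => (j = i + 1 ∨ i = j + 1) ∧ i + j ∈ ({1, 3, 7} : Finset ℕ)) (by grind) ?_ ?_
  · rintro i hi j hj ⟨h, -⟩
    exact (hp i hi j hj).2 (by omega)
  · intro f g hG hr
    simp only [Finset.mem_insert, Finset.mem_singleton] at hr
    have hr01 := (hr.rel 0 (by omega) 1 (by omega)).2 (by omega)
    have hr12 := (hr.rel 1 (by omega) 2 (by omega)).2 (by omega)
    have hr34 := (hr.rel 3 (by omega) 4 (by omega)).2 (by omega)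
    have h02 := hr.injOn (i := 0) (j := 2) (by omega) (by omega)
    have h13 := hr.injOn (i := 1) (j := 3) (by omega) (by omega)
    have h1 : f 1 = 1 := by omega
    have h0 : f 0 = 0 := by
      by_contra hne
      have hf2 : f 2 = 0 := by omega
      have h₁ := (hG.rel 2 (by omega) 3 (by omega)).2 ((hp _ (by omega) _ (by omega)).2 (by omega))
      rw [hp _ (hr.lt _ (by omega)) _ (hr.lt _ (by omega))] at h₁
      omega
    refine hG.eq_self (k := 1) ?_ ?_ ?_
    · intro i hi _
      interval_cases i <;> assumption
    · exact fun i _ hi => Or.inl ((hp _ (by omega) _ hi).2 (by omega))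
    · intro i j _ hi hj hij
      rw [hp i hi j hj] at hij
      omega

/-- Adjacency of indices after rotating the enumeration by `t`. -/
theorem indexAdj_addRight {V : Type*} {G : SimpleGraph V} {n : ℕ} [NeZero n] (p : Fin n ≃ V)
    (t : Fin n) {i j : ℕ} (hi : i < n) (hj : j < n)
    (h : indexAdj G p ((i + t) % n) ((j + t) % n)) :
    indexAdj G ((Equiv.addRight t).trans p) i j := by
  obtain ⟨_, _, h⟩ := h
  exact ⟨hi, hj, h⟩

/-- A Hamiltonian cycle with a chord yields a distinguishing colouring. -/
theorem hasDistinguishingEdgeColoring_of_cycle_of_chord {V : Type*} {G : SimpleGraph V} {n : ℕ}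
    (hn : 7 ≤ n) (p : Fin n ≃ V) (hp : ∀ i, i + 1 < n → indexAdj G p i (i + 1))
    (hends : indexAdj G p 0 (n - 1)) {x y : ℕ} (hxy : x + 2 ≤ y) (hyn : y < n)
    (hne : y + 2 ≤ n + x) (hchord : indexAdj G p x y) : HasDistinguishingEdgeColoring G 2 := by
  have : NeZero n := ⟨by omega⟩
  have hrot (t : Fin n) (i : ℕ) (hi : i + 1 < n) :
      indexAdj G ((Equiv.addRight t).trans p) i (i + 1) := by
    refine indexAdj_addRight p t (by omega) hi ?_
    have ht := t.2
    rcases lt_trichotomy (i + 1 + t.1) n with h | h | h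
    · rw [Nat.mod_eq_of_lt h, Nat.mod_eq_of_lt (by omega),
        show i + 1 + t.1 = i + t.1 + 1 by omega]
      exact hp _ (by omega)
    · rw [h, Nat.mod_self, Nat.mod_eq_of_lt (by omega), show i + t.1 = n - 1 by omega]
      exact indexAdj_comm.1 hends
    · rw [Nat.mod_eq_sub_mod (by omega), Nat.mod_eq_sub_mod (by omega : n ≤ i + 1 + t.1),
        Nat.mod_eq_of_lt (by omega), Nat.mod_eq_of_lt (by omega),
        show i + 1 + t.1 - n = i + t.1 - n + 1 by omega]
      exact hp _ (by omega)
  by_cases hd : y - x + 4 ≤ n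
  · let t : Fin n := ⟨(x + (n - 1)) % n, Nat.mod_lt _ (by omega)⟩
    refine hasDistinguishingEdgeColoring_of_chord (k := y - x + 1) _ (hrot t)
      (by omega) (by omega) (indexAdj_addRight p t (by omega) (by omega) ?_)
    simp only [t, Nat.add_mod_mod]
    rw [show 1 + (x + (n - 1)) = x + n by omega,
      show y - x + 1 + (x + (n - 1)) = y + n by omega, Nat.add_mod_right, Nat.add_mod_right,
      Nat.mod_eq_of_lt (by omega), Nat.mod_eq_of_lt hyn]
    exact hchord
  · let t : Fin n := ⟨y - 1, by omega⟩
    refine hasDistinguishingEdgeColoring_of_chord (k := n + x - y + 1) _ (hrot t)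
      (by omega) (by omega) (indexAdj_addRight p t (by omega) (by omega) ?_)
    simp only [t]
    rw [show 1 + (y - 1) = y by omega, show n + x - y + 1 + (y - 1) = x + n by omega,
      Nat.add_mod_right, Nat.mod_eq_of_lt (by omega), Nat.mod_eq_of_lt (by omega)]
    exact indexAdj_comm.1 hchord

/-- A finite connected simple graph with at least 7 vertices containing a Hamiltonian path
admits a distinguishing edge colouring with two colours. -/
theorem stmt_12 {V : Type*} [Fintype V] [DecidableEq V] (G : SimpleGraph V)
    (hconn : G.Connected) (hcard : 7 ≤ Fintype.card V)
    (hham : ∃ (u v : V) (p : G.Walk u v), p.IsHamiltonian) :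
    HasDistinguishingEdgeColoring G 2 := by
  obtain ⟨u, v, w, hw⟩ := hham
  obtain ⟨n, hn, p, hp⟩ : ∃ n, 7 ≤ n ∧ ∃ p : Fin n ≃ V,
      ∀ i, i + 1 < n → indexAdj G p i (i + 1) := by
    refine ⟨w.support.length, hw.length_support ▸ hcard, hw.getVertEquiv, fun i hi => ?_⟩
    have hi' : i < w.length := by rw [Walk.length_support] at hi; omega
    exact ⟨by omega, hi, w.adj_getVert_succ hi'⟩
  by_cases hends : indexAdj G p 0 (n - 1)
  swap
  · exact hasDistinguishingEdgeColoring_of_not_adj_ends (by omega) p hp hends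
  by_cases hchord : ∃ x y, x + 2 ≤ y ∧ y < n ∧ y + 2 ≤ n + x ∧ indexAdj G p x y
  · obtain ⟨x, y, hxy, hyn, hne, h⟩ := hchord
    exact hasDistinguishingEdgeColoring_of_cycle_of_chord hn p hp hends hxy hyn hne h
  push Not at hchord
  refine hasDistinguishingEdgeColoring_of_cycle (by omega) p fun i hi j hj => ⟨fun h => ?_, ?_⟩
  · have hij : i ≠ j := by
      rintro rfl
      obtain ⟨_, _, h⟩ := h
      exact h.ne rfl
    have h₁ : ¬ (i + 2 ≤ j ∧ j + 2 ≤ n + i) := fun h' => hchord i j h'.1 hj h'.2 h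
    have h₂ : ¬ (j + 2 ≤ i ∧ i + 2 ≤ n + j) := fun h' =>
      hchord j i h'.1 hi h'.2 (indexAdj_comm.1 h)
    omega
  · rintro (rfl | rfl | ⟨rfl, rfl⟩ | ⟨rfl, rfl⟩)
    · exact hp _ hj
    · exact indexAdj_comm.1 (hp _ hi)
    · exact hends
    · exact indexAdj_comm.1 hends
end
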